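/- arXiv:0708.2304 — 13 statements merged into one kernel-verified Lean document; each statement's English description precedes it below -/
import Mathlib

section
/- Let f : ℤ^m → ℝ be a real-valued function of m integer variables, and let g : ℤ → ℝ be a strictly increasing function such that f([a,b]^m) ⊆ [g(a), g(b)] for all integers a < b. Let ℓ and λ be positive integers with ℓ ≥ 2 such that N_f(ℓ) ≥ λ. Let A = {a_0 < a_1 < ⋯ < a_{k-1}} be a set of k integers, write k − 1 = q(ℓ−1) + r with 0 ≤ r ≤ ℓ−2, and set μ(A) = |f({a_{k-r-1}, a_{k-r}, …, a_{k-1}})|. Then |f(A)| ≥ (λ−1)·(k−r−1)/(ℓ−1) + μ(A), and consequently N_f(k) ≥ ((λ−1)/(ℓ−1))·k − λ + 2 for every positive integer k. -/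
open Finset

/-- The image set `f(A) = {f(a_1,…,a_m) : a_i ∈ A}` of a finite set of integers under a
real-valued function of `m` integer variables. -/
noncomputable def fimgR (m : ℕ) (f : (Fin m → ℤ) → ℝ) (A : Finset ℤ) : Finset ℝ :=
  (Fintype.piFinset fun _ : Fin m => A).image f

/-- `N_f(k) = min { |f(A)| : A ⊆ ℤ, |A| = k }`. -/
noncomputable def NfR (m : ℕ) (f : (Fin m → ℤ) → ℝ) (k : ℕ) : ℕ :=
  sInf {n : ℕ | ∃ A : Finset ℤ, A.card = k ∧ (fimgR m f A).card = n}

theorem fimgR_mono (m : ℕ) (f : (Fin m → ℤ) → ℝ) {A B : Finset ℤ} (h : A ⊆ B) :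
    fimgR m f A ⊆ fimgR m f B := by
  unfold fimgR
  exact Finset.image_subset_image (Fintype.piFinset_subset _ _ fun _ => h)

theorem NfR_le (m : ℕ) (f : (Fin m → ℤ) → ℝ) (A : Finset ℤ) :
    NfR m f A.card ≤ (fimgR m f A).card :=
  Nat.sInf_le ⟨A, rfl, rfl⟩

theorem fimgR_pos (m : ℕ) (f : (Fin m → ℤ) → ℝ) (A : Finset ℤ) (h : A.Nonempty) :
    1 ≤ (fimgR m f A).card := by
  obtain ⟨x, hx⟩ := h
  apply Finset.card_pos.mpr
  refine ⟨f fun _ => x, ?_⟩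
  unfold fimgR
  exact Finset.mem_image_of_mem _ (by simpa using fun _ => hx)

theorem fimgR_le (m : ℕ) (f : (Fin m → ℤ) → ℝ) (g : ℤ → ℝ)
    (hfg : ∀ a b : ℤ, a < b → ∀ x : Fin m → ℤ,
      (∀ i, x i ∈ Finset.Icc a b) → f x ∈ Set.Icc (g a) (g b))
    (B : Finset ℤ) (c : ℤ) (hB : ∀ b ∈ B, b ≤ c) (y : ℝ) (hy : y ∈ fimgR m f B) : y ≤ g c := by
  unfold fimgR at hy
  obtain ⟨x, hx, rfl⟩ := Finset.mem_image.mp hy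
  rw [Fintype.mem_piFinset] at hx
  obtain ⟨d, hd⟩ := B.bddBelow
  refine (hfg (min d (c - 1)) c (by omega) x fun i => ?_).2
  have h1 := hB _ (hx i)
  have h2 : d ≤ x i := hd (hx i)
  rw [Finset.mem_Icc]
  omega

theorem le_fimgR (m : ℕ) (f : (Fin m → ℤ) → ℝ) (g : ℤ → ℝ)
    (hfg : ∀ a b : ℤ, a < b → ∀ x : Fin m → ℤ,
      (∀ i, x i ∈ Finset.Icc a b) → f x ∈ Set.Icc (g a) (g b))
    (B : Finset ℤ) (c : ℤ) (hB : ∀ b ∈ B, c ≤ b) (y : ℝ) (hy : y ∈ fimgR m f B) : g c ≤ y := by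
  unfold fimgR at hy
  obtain ⟨x, hx, rfl⟩ := Finset.mem_image.mp hy
  rw [Fintype.mem_piFinset] at hx
  obtain ⟨d, hd⟩ := B.bddAbove
  refine (hfg c (max d (c + 1)) (by omega) x fun i => ?_).1
  have h1 := hB _ (hx i)
  have h2 : x i ≤ d := hd (hx i)
  rw [Finset.mem_Icc]
  omega

theorem fimgR_split (m : ℕ) (f : (Fin m → ℤ) → ℝ) (g : ℤ → ℝ)
    (hfg : ∀ a b : ℤ, a < b → ∀ x : Fin m → ℤ,
      (∀ i, x i ∈ Finset.Icc a b) → f x ∈ Set.Icc (g a) (g b))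
    (A B C : Finset ℤ) (c : ℤ) (hB : ∀ b ∈ B, b ≤ c) (hC : ∀ b ∈ C, c ≤ b)
    (hBA : B ⊆ A) (hCA : C ⊆ A) :
    (fimgR m f B).card + (fimgR m f C).card ≤ (fimgR m f A).card + 1 := by
  rw [← Finset.card_union_add_card_inter]
  apply Nat.add_le_add
  · exact Finset.card_le_card
      (Finset.union_subset (fimgR_mono m f hBA) (fimgR_mono m f hCA))
  · have : fimgR m f B ∩ fimgR m f C ⊆ {g c} := by
      intro y hy
      rw [Finset.mem_inter] at hy
      rw [Finset.mem_singleton]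
      exact le_antisymm (fimgR_le m f g hfg B c hB y hy.1) (le_fimgR m f g hfg C c hC y hy.2)
    simpa using Finset.card_le_card this

theorem fimgR_main (m : ℕ) (f : (Fin m → ℤ) → ℝ) (g : ℤ → ℝ)
    (hfg : ∀ a b : ℤ, a < b → ∀ x : Fin m → ℤ,
      (∀ i, x i ∈ Finset.Icc a b) → f x ∈ Set.Icc (g a) (g b))
    (l lam : ℕ) (hl : 2 ≤ l) (hlam : 1 ≤ lam) (hN : lam ≤ NfR m f l)
    (k : ℕ) (a : Fin k → ℤ) (ha : StrictMono a) (j : ℕ) (hj : j * (l - 1) < k) :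
    (lam - 1) * j +
        (fimgR m f ((Finset.univ.filter fun i : Fin k => j * (l - 1) ≤ (i : ℕ)).image a)).card
      ≤ (fimgR m f (Finset.univ.image a)).card := by
  induction j with
  | zero => simp
  | succ j ih =>
    have e : (j + 1) * (l - 1) = j * (l - 1) + (l - 1) := by ring
    rw [e] at hj ⊢
    have ih := ih (by omega)
    generalize j * (l - 1) = s at *
    have hBc : ((Finset.Icc (⟨s, by omega⟩ : Fin k) ⟨s + (l - 1), hj⟩).image a).card = l := by
      rw [Finset.card_image_of_injective _ ha.injective, Fin.card_Icc]
      simp only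
      omega
    have h1 := NfR_le m f ((Finset.Icc (⟨s, by omega⟩ : Fin k) ⟨s + (l - 1), hj⟩).image a)
    rw [hBc] at h1
    have h2 := fimgR_split m f g hfg
      ((Finset.univ.filter fun i : Fin k => s ≤ (i : ℕ)).image a)
      ((Finset.Icc (⟨s, by omega⟩ : Fin k) ⟨s + (l - 1), hj⟩).image a)
      ((Finset.univ.filter fun i : Fin k => s + (l - 1) ≤ (i : ℕ)).image a)
      (a ⟨s + (l - 1), hj⟩)
      (by
        intro b hb
        obtain ⟨i, hi, rfl⟩ := Finset.mem_image.mp hb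
        exact ha.monotone (Finset.mem_Icc.mp hi).2)
      (by
        intro b hb
        obtain ⟨i, hi, rfl⟩ := Finset.mem_image.mp hb
        exact ha.monotone (Fin.le_def.mpr (Finset.mem_filter.mp hi).2))
      (by
        apply Finset.image_subset_image
        intro i hi
        exact Finset.mem_filter.mpr ⟨Finset.mem_univ _, Fin.le_def.mp (Finset.mem_Icc.mp hi).1⟩)
      (by
        apply Finset.image_subset_image
        intro i hi
        have := (Finset.mem_filter.mp hi).2
        exact Finset.mem_filter.mpr ⟨Finset.mem_univ _, by omega⟩)
    rw [Nat.mul_succ]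
    omega

theorem stmt0 (m : ℕ) (f : (Fin m → ℤ) → ℝ) (g : ℤ → ℝ) (hg : StrictMono g)
    (hfg : ∀ a b : ℤ, a < b → ∀ x : Fin m → ℤ,
      (∀ i, x i ∈ Finset.Icc a b) → f x ∈ Set.Icc (g a) (g b))
    (l lam : ℕ) (hl : 2 ≤ l) (hlam : 1 ≤ lam) (hN : lam ≤ NfR m f l)
    (k q r : ℕ) (hk : 1 ≤ k) (a : Fin k → ℤ) (ha : StrictMono a)
    (hqr : k - 1 = q * (l - 1) + r) (hr : r ≤ l - 2) :
    (lam - 1) * q +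
        (fimgR m f ((Finset.univ.filter fun i : Fin k => k - r - 1 ≤ (i : ℕ)).image a)).card
      ≤ (fimgR m f (Finset.univ.image a)).card ∧
    ∀ k' : ℕ, 1 ≤ k' →
      ((lam : ℝ) - 1) / ((l : ℝ) - 1) * (k' : ℝ) - (lam : ℝ) + 2 ≤ (NfR m f k' : ℝ) := by
  have part1 : ∀ (k q r : ℕ) (_ : 1 ≤ k) (a : Fin k → ℤ) (_ : StrictMono a)
      (_ : k - 1 = q * (l - 1) + r),
      (lam - 1) * q +
        (fimgR m f ((Finset.univ.filter fun i : Fin k => k - r - 1 ≤ (i : ℕ)).image a)).card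
      ≤ (fimgR m f (Finset.univ.image a)).card := by
    intro k q r hk a ha hqr
    have e : k - r - 1 = q * (l - 1) := by omega
    rw [e]
    exact fimgR_main m f g hfg l lam hl hlam hN k a ha q (by omega)
  refine ⟨part1 k q r hk a ha hqr, ?_⟩
  intro k' hk'
  have hne : {n : ℕ | ∃ A : Finset ℤ, A.card = k' ∧ (fimgR m f A).card = n}.Nonempty := by
    obtain ⟨A, hA⟩ := Infinite.exists_subset_card_eq ℤ k'
    exact ⟨_, A, hA, rfl⟩
  obtain ⟨A, hA, hAn⟩ := Nat.sInf_mem hne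
  change _ = NfR m f k' at hAn
  have hq := Nat.div_add_mod' (k' - 1) (l - 1)
  have hm := Nat.mod_lt (k' - 1) (show 0 < l - 1 by omega)
  have h1 := part1 k' ((k' - 1) / (l - 1)) ((k' - 1) % (l - 1)) hk'
    (A.orderEmbOfFin hA) (A.orderEmbOfFin hA).strictMono hq.symm
  have him : Finset.univ.image (A.orderEmbOfFin hA) = A := by
    simp
  rw [him, hAn] at h1
  have h2 := fimgR_pos m f ((Finset.univ.filter fun i : Fin k' =>
      k' - (k' - 1) % (l - 1) - 1 ≤ (i : ℕ)).image (A.orderEmbOfFin hA))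
    ⟨_, Finset.mem_image_of_mem _ (Finset.mem_filter.mpr
      ⟨Finset.mem_univ (⟨k' - 1, by omega⟩ : Fin k'), by simp only; omega⟩)⟩
  have h3 := (Nat.add_le_add_left h2 _).trans h1
  generalize (k' - 1) / (l - 1) = Q at *
  generalize (k' - 1) % (l - 1) = R at *
  obtain ⟨L, rfl⟩ : ∃ L, l = L + 1 := ⟨l - 1, by omega⟩
  obtain ⟨M, rfl⟩ : ∃ M, lam = M + 1 := ⟨lam - 1, by omega⟩
  simp only [Nat.add_sub_cancel] at *
  have h4 : (M : ℝ) * Q + 1 ≤ NfR m f k' := by exact_mod_cast h3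
  have hk2 : k' ≤ Q * L + L := by omega
  have h5 : (k' : ℝ) ≤ Q * L + L := by exact_mod_cast hk2
  have hL : (0 : ℝ) < L := by
    have : 0 < L := by omega
    exact_mod_cast this
  have h6 : (M : ℝ) / L * k' ≤ M / L * (Q * L + L) :=
    mul_le_mul_of_nonneg_left h5 (by positivity)
  have h7 : (M : ℝ) / L * (Q * L + L) = M * Q + M := by
    field_simp
  push_cast
  simp only [add_sub_cancel_right]
  linarith
end

section
/- Let f(x_1,...,x_m) = u_1x_1 + ⋯ + u_mx_m be an m-ary linear form with positive integer coefficients. If ℓ and λ are positive integers with ℓ ≥ 2 such that N_f(ℓ) ≥ λ, then N_f(k) ≥ ((λ−1)/(ℓ−1))·k − λ + 2 for every positive integer k. -/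
open Finset

/-- The image set `f(A) = {u_1 a_1 + ⋯ + u_m a_m : a_i ∈ A}` of a finite set of integers
under the `m`-ary linear form with coefficients `u`. -/
def fimg (m : ℕ) (u : Fin m → ℤ) (A : Finset ℤ) : Finset ℤ :=
  (Fintype.piFinset fun _ : Fin m => A).image fun x => ∑ j, u j * x j

/-- `N_f(k) = min { |f(A)| : A ⊆ ℤ, |A| = k }`. -/
noncomputable def Nf (m : ℕ) (u : Fin m → ℤ) (k : ℕ) : ℕ :=
  sInf {n : ℕ | ∃ A : Finset ℤ, A.card = k ∧ (fimg m u A).card = n}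

/-- `M_f(k) = max { |f(A)| : A ⊆ ℤ, |A| = k }`. -/
noncomputable def Mf (m : ℕ) (u : Fin m → ℤ) (k : ℕ) : ℕ :=
  sSup {n : ℕ | ∃ A : Finset ℤ, A.card = k ∧ (fimg m u A).card = n}

lemma exists_split (A : Finset ℤ) : ∀ n : ℕ, 1 ≤ n → n ≤ A.card →
    ∃ c ∈ A, (A.filter (· ≤ c)).card = n := by
  induction A using Finset.induction_on_max with
  | empty => intro n h1 h2; simp at h2; omega
  | insert a s ha ih =>
    intro n h1 h2
    have hna : a ∉ s := fun h => lt_irrefl _ (ha a h)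
    rw [Finset.card_insert_of_notMem hna] at h2
    rcases Nat.lt_or_ge s.card n with h | h
    · refine ⟨a, Finset.mem_insert_self _ _, ?_⟩
      rw [Finset.filter_true_of_mem, Finset.card_insert_of_notMem hna]
      · omega
      · intro x hx
        rcases Finset.mem_insert.1 hx with rfl | hx
        · exact le_rfl
        · exact (ha x hx).le
    · obtain ⟨c, hc, hcard⟩ := ih n h1 h
      refine ⟨c, Finset.mem_insert_of_mem hc, ?_⟩
      rw [Finset.filter_insert, if_neg (not_le.2 (ha c hc)), hcard]

lemma fimg_mono (m : ℕ) (u : Fin m → ℤ) {A B : Finset ℤ} (h : A ⊆ B) :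
    fimg m u A ⊆ fimg m u B := by
  unfold fimg
  exact Finset.image_subset_image (Fintype.piFinset_subset _ _ fun _ => h)

lemma fimg_blocks (m : ℕ) (u : Fin m → ℤ) (hu : ∀ j, 0 < u j)
    (l lam : ℕ) (hl : 2 ≤ l) (hlam : 1 ≤ lam) (hN : lam ≤ Nf m u l) (q : ℕ) :
    ∀ A : Finset ℤ, q * (l - 1) + 1 ≤ A.card → q * (lam - 1) + 1 ≤ (fimg m u A).card := by
  induction q with
  | zero =>
    intro A hA
    obtain ⟨a, ha⟩ := Finset.card_pos.1 (by omega : 0 < A.card)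
    have : (fimg m u A).Nonempty :=
      ⟨∑ j, u j * a, Finset.mem_image.2 ⟨fun _ => a, by simp [ha], rfl⟩⟩
    have := Finset.card_pos.2 this
    omega
  | succ q ih =>
    intro A hA
    rw [Nat.succ_mul] at hA
    obtain ⟨c, hc, hB⟩ := exists_split A l (by omega) (by omega)
    have hC : q * (l - 1) + 1 ≤ (A.filter (c ≤ ·)).card := by
      have h1 : A ⊆ (A.filter (· ≤ c)) ∪ (A.filter (c ≤ ·)).erase c := by
        intro x hx
        simp only [Finset.mem_union, Finset.mem_filter, Finset.mem_erase]
        rcases le_or_gt x c with h | h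
        · exact Or.inl ⟨hx, h⟩
        · exact Or.inr ⟨h.ne', hx, h.le⟩
      have h2 := (Finset.card_le_card h1).trans (Finset.card_union_le _ _)
      rw [Finset.card_erase_of_mem (by simp [hc]), hB] at h2
      have h3 : 0 < (A.filter (c ≤ ·)).card := Finset.card_pos.2 ⟨c, by simp [hc]⟩
      omega
    have hfC := ih _ hC
    have hfB : lam ≤ (fimg m u (A.filter (· ≤ c))).card :=
      hN.trans (Nat.sInf_le ⟨_, hB, rfl⟩)
    have hU : (fimg m u (A.filter (· ≤ c)) ∪ fimg m u (A.filter (c ≤ ·))).card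
        ≤ (fimg m u A).card :=
      Finset.card_le_card (Finset.union_subset (fimg_mono m u (Finset.filter_subset _ _))
        (fimg_mono m u (Finset.filter_subset _ _)))
    have hI : (fimg m u (A.filter (· ≤ c)) ∩ fimg m u (A.filter (c ≤ ·))).card ≤ 1 := by
      have : fimg m u (A.filter (· ≤ c)) ∩ fimg m u (A.filter (c ≤ ·)) ⊆ {∑ j, u j * c} := by
        intro y hy
        obtain ⟨hy1, hy2⟩ := Finset.mem_inter.1 hy
        obtain ⟨x, hx, hxy⟩ := Finset.mem_image.1 hy1
        obtain ⟨z, hz, hzy⟩ := Finset.mem_image.1 hy2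
        rw [Fintype.mem_piFinset] at hx hz
        rw [Finset.mem_singleton]
        apply le_antisymm
        · rw [← hxy]
          exact Finset.sum_le_sum fun j _ =>
            mul_le_mul_of_nonneg_left (Finset.mem_filter.1 (hx j)).2 (hu j).le
        · rw [← hzy]
          exact Finset.sum_le_sum fun j _ =>
            mul_le_mul_of_nonneg_left (Finset.mem_filter.1 (hz j)).2 (hu j).le
      simpa using Finset.card_le_card this
    have := Finset.card_union_add_card_inter (fimg m u (A.filter (· ≤ c)))
      (fimg m u (A.filter (c ≤ ·)))
    rw [Nat.succ_mul]
    omega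

theorem stmt1 (m : ℕ) (hm : 0 < m) (u : Fin m → ℤ) (hu : ∀ j, 0 < u j)
    (l lam : ℕ) (hl : 2 ≤ l) (hlam : 1 ≤ lam) (hN : lam ≤ Nf m u l)
    (k : ℕ) (hk : 1 ≤ k) :
    ((lam : ℝ) - 1) / ((l : ℝ) - 1) * (k : ℝ) - (lam : ℝ) + 2 ≤ (Nf m u k : ℝ) := by
  have hne : {n : ℕ | ∃ A : Finset ℤ, A.card = k ∧ (fimg m u A).card = n}.Nonempty := by
    obtain ⟨A, hA⟩ := Infinite.exists_subset_card_eq ℤ k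
    exact ⟨_, A, hA, rfl⟩
  obtain ⟨A, hA, hAN⟩ := Nat.sInf_mem hne
  change (fimg m u A).card = Nf m u k at hAN
  obtain ⟨p, rfl⟩ : ∃ p, l = p + 2 := ⟨l - 2, by omega⟩
  obtain ⟨t, rfl⟩ : ∃ t, lam = t + 1 := ⟨lam - 1, by omega⟩
  have hdiv := Nat.div_add_mod (k - 1) (p + 1)
  have hmod := Nat.mod_lt (k - 1) (Nat.succ_pos p)
  set q := (k - 1) / (p + 1) with hq
  have key := fimg_blocks m u hu _ _ hl hlam hN q A (by
    rw [hA, show p + 2 - 1 = p + 1 from rfl, mul_comm]; omega)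
  rw [hAN, Nat.add_sub_cancel] at key
  have hkq : k ≤ (p + 1) * q + (p + 1) := by
    simp only [Nat.succ_eq_add_one] at hmod
    omega
  have key' : (q : ℝ) * t + 1 ≤ (Nf m u k : ℝ) := by exact_mod_cast key
  have hkq' : (k : ℝ) ≤ ((p : ℝ) + 1) * q + (p + 1) := by exact_mod_cast hkq
  have hp : (0 : ℝ) < (p : ℝ) + 1 := by positivity
  have h3 : (k : ℝ) / ((p : ℝ) + 1) ≤ q + 1 := by
    rw [div_le_iff₀ hp]; linarith
  have h4 := mul_le_mul_of_nonneg_left h3 (Nat.cast_nonneg (α := ℝ) t)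
  have h5 : (((t + 1 : ℕ) : ℝ) - 1) / (((p + 2 : ℕ) : ℝ) - 1) * (k : ℝ)
      = (t : ℝ) * ((k : ℝ) / ((p : ℝ) + 1)) := by
    push_cast
    rw [show (p : ℝ) + 2 - 1 = p + 1 by ring]
    ring
  rw [h5]
  push_cast
  linarith
end

section
/- Let f(x_1,...,x_m) = u_1x_1 + ⋯ + u_mx_m be an m-ary linear form with positive integer coefficients satisfying 1 ≤ u_1 < u_2 < ⋯ < u_m. Then for every positive integer k, N_f(k) ≥ ((m²+m)/2)·k − (m²+m−2)/2. -/
open Finset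

theorem subsums {m : ℕ} (u : Fin m → ℤ) (hu : ∀ j, 0 < u j) (hmono : StrictMono u)
    (t : Finset (Fin m)) :
    t.card * (t.card + 1) + 2 ≤ 2 * (t.powerset.image (fun s => ∑ j ∈ s, u j)).card := by
  induction t using Finset.induction_on_max with
  | empty => simp
  | insert x t hx ih =>
    have hxt : x ∉ t := fun h => lt_irrefl _ (hx x h)
    set P := t.powerset.image (fun s => ∑ j ∈ s, u j) with hP
    set σ := ∑ j ∈ t, u j with hσ
    set Q := insert (σ + u x) (t.image (fun y => σ + u x - u y)) with hQ
    have hQc : Q.card = t.card + 1 := by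
      rw [hQ, Finset.card_insert_of_notMem, Finset.card_image_of_injective]
      · intro a b hab
        apply hmono.injective
        simp only at hab
        linarith
      · simp only [Finset.mem_image, not_exists, not_and]
        intro y _ h
        have := hu y
        linarith
    have hdisj : Disjoint P Q := by
      rw [Finset.disjoint_left]
      intro z hz hzQ
      have h1 : z ≤ σ := by
        simp only [hP, Finset.mem_image, Finset.mem_powerset] at hz
        obtain ⟨s, hs, rfl⟩ := hz
        exact Finset.sum_le_sum_of_subset_of_nonneg hs (fun i _ _ => (hu i).le)
      simp only [hQ, Finset.mem_insert, Finset.mem_image] at hzQ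
      rcases hzQ with rfl | ⟨y, hy, rfl⟩
      · have := hu x
        linarith
      · have := hmono (hx y hy)
        linarith
    have hsub : P ∪ Q ⊆ (insert x t).powerset.image (fun s => ∑ j ∈ s, u j) := by
      intro z hz
      simp only [hP, hQ, Finset.mem_union, Finset.mem_insert, Finset.mem_image,
        Finset.mem_powerset] at hz ⊢
      rcases hz with ⟨s, hs, rfl⟩ | rfl | ⟨y, hy, rfl⟩
      · exact ⟨s, hs.trans (Finset.subset_insert _ _), rfl⟩
      · exact ⟨insert x t, subset_rfl, by rw [Finset.sum_insert hxt, add_comm]⟩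
      · refine ⟨(insert x t).erase y, Finset.erase_subset _ _, ?_⟩
        have := Finset.add_sum_erase (insert x t) u (Finset.mem_insert_of_mem hy)
        rw [Finset.sum_insert hxt] at this
        linarith
    have := Finset.card_le_card hsub
    rw [Finset.card_union_of_disjoint hdisj, hQc] at this
    rw [Finset.card_insert_of_notMem hxt]
    nlinarith

theorem fimg_bound {m : ℕ} (u : Fin m → ℤ) (hu : ∀ j, 0 < u j) (hmono : StrictMono u)
    (A : Finset ℤ) : A.Nonempty →
    m * (m + 1) * A.card + 2 ≤ 2 * (fimg m u A).card + m * (m + 1) := by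
  induction A using Finset.induction_on_max with
  | empty => simp
  | insert a A ha ih =>
    intro _
    have haA : a ∉ A := fun h => lt_irrefl _ (ha a h)
    rcases A.eq_empty_or_nonempty with rfl | hne
    · have : 0 < (fimg m u (insert a ∅)).card := by
        rw [Finset.card_pos]
        unfold fimg
        refine Finset.Nonempty.image ⟨fun _ => a, ?_⟩ _
        simp
      rw [Finset.card_insert_of_notMem haA, Finset.card_empty]
      linarith
    have ih := ih hne
    set b := A.max' hne with hb
    have hbA : b ∈ A := A.max'_mem hne
    have hab : b < a := ha b hbA
    have hS := subsums u hu hmono Finset.univ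
    set S := (Finset.univ : Finset (Fin m)).powerset.image (fun s => ∑ j ∈ s, u j) with hSdef
    set Q := (S.erase 0).image (fun s => (∑ j, u j) * b + (a - b) * s) with hQ
    have h0S : (0 : ℤ) ∈ S := by
      rw [hSdef, Finset.mem_image]
      exact ⟨∅, by simp, by simp⟩
    have hQc : Q.card + 1 = S.card := by
      rw [hQ, Finset.card_image_of_injective, Finset.card_erase_add_one h0S]
      intro x y hxy
      simp only [add_right_inj] at hxy
      exact mul_left_cancel₀ (sub_ne_zero.2 (ne_of_gt hab)) hxy
    have hdisj : Disjoint (fimg m u A) Q := by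
      rw [Finset.disjoint_left]
      intro z hz hzQ
      have h1 : z ≤ (∑ j, u j) * b := by
        simp only [fimg, Finset.mem_image, Fintype.mem_piFinset] at hz
        obtain ⟨x, hx, rfl⟩ := hz
        rw [Finset.sum_mul]
        exact Finset.sum_le_sum fun i _ =>
          mul_le_mul_of_nonneg_left (A.le_max' _ (hx i)) (hu i).le
      simp only [hQ, hSdef, Finset.mem_image, Finset.mem_erase] at hzQ
      obtain ⟨_, ⟨h0, s, _, rfl⟩, rfl⟩ := hzQ
      have h2 : 0 ≤ ∑ j ∈ s, u j := Finset.sum_nonneg fun i _ => (hu i).le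
      have h3 : 0 < (a - b) * ∑ j ∈ s, u j :=
        mul_pos (sub_pos.2 hab) (lt_of_le_of_ne h2 (Ne.symm h0))
      linarith
    have hsub : fimg m u A ∪ Q ⊆ fimg m u (insert a A) := by
      intro z hz
      simp only [hQ, hSdef, fimg, Finset.mem_union, Finset.mem_image, Finset.mem_erase,
        Fintype.mem_piFinset] at hz ⊢
      rcases hz with ⟨x, hx, rfl⟩ | ⟨_, ⟨_, s, _, rfl⟩, rfl⟩
      · exact ⟨x, fun i => Finset.mem_insert_of_mem (hx i), rfl⟩
      · refine ⟨fun i => if i ∈ s then a else b, fun i => ?_, ?_⟩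
        · dsimp only
          split_ifs
          · exact Finset.mem_insert_self _ _
          · exact Finset.mem_insert_of_mem hbA
        · have : ∀ i, u i * (if i ∈ s then a else b)
              = u i * b + (a - b) * (if i ∈ s then u i else 0) := by
            intro i
            split_ifs <;> ring
          simp only [this]
          rw [Finset.sum_add_distrib, ← Finset.sum_mul, ← Finset.mul_sum]
          simp
    have := Finset.card_le_card hsub
    rw [Finset.card_union_of_disjoint hdisj] at this
    rw [Finset.card_insert_of_notMem haA]
    rw [Finset.card_univ, Fintype.card_fin] at hS
    nlinarith

theorem stmt2 (m : ℕ) (hm : 0 < m) (u : Fin m → ℤ) (hu : ∀ j, 0 < u j)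
    (hmono : StrictMono u) (k : ℕ) (hk : 0 < k) :
    ((m : ℤ) ^ 2 + m) / 2 * k - ((m : ℤ) ^ 2 + m - 2) / 2 ≤ (Nf m u k : ℤ) := by
  have hne : {n : ℕ | ∃ A : Finset ℤ, A.card = k ∧ (fimg m u A).card = n}.Nonempty := by
    obtain ⟨A, hA⟩ := Infinite.exists_subset_card_eq ℤ k
    exact ⟨_, A, hA, rfl⟩
  obtain ⟨A, hA, hN⟩ := Nat.sInf_mem hne
  change _ = Nf m u k at hN
  have h := fimg_bound u hu hmono A (Finset.card_pos.1 (by omega))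
  rw [hN, hA] at h
  obtain ⟨T, hT⟩ : (2 : ℤ) ∣ (m : ℤ) ^ 2 + m := by
    have := Int.even_mul_succ_self (m : ℤ)
    rw [show (m : ℤ) ^ 2 + m = m * (m + 1) by ring]
    exact this.two_dvd
  have h' : ((m : ℤ) ^ 2 + m) * k + 2 ≤ 2 * (Nf m u k : ℤ) + ((m : ℤ) ^ 2 + m) := by
    have : ((m * (m + 1) * k + 2 : ℕ) : ℤ) ≤ ((2 * Nf m u k + m * (m + 1) : ℕ) : ℤ) := by
      exact_mod_cast h
    push_cast at this
    linarith
  rw [hT] at h' ⊢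
  rw [show 2 * T / 2 = T by omega, show (2 * T - 2) / 2 = T - 1 by omega]
  linarith
end

section
/- For all positive integers m and k, the minimum of N_f(k) over all m-ary linear forms f(x_1,...,x_m) = u_1x_1 + ⋯ + u_mx_m with positive integer coefficients satisfying 1 ≤ u_1 < u_2 < ⋯ < u_m equals ((m²+m)/2)·k − (m²+m−2)/2; moreover this minimum is attained by the form f(x_1,...,x_m) = x_1 + 2x_2 + ⋯ + mx_m on the set A = {0,1,...,k−1}. -/
open Finset

lemma mem_fimg_iff (m : ℕ) (u : Fin m → ℤ) (A : Finset ℤ) (z : ℤ) :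
    z ∈ fimg m u A ↔ ∃ x : Fin m → ℤ, (∀ j, x j ∈ A) ∧ ∑ j, u j * x j = z := by
  simp [fimg, Fintype.mem_piFinset]

/-- Distinct positive integers have at least `m(m+1)/2 + 1` subset sums. -/
lemma subset_sums (m : ℕ) : ∀ u : Fin m → ℤ, (∀ j, 0 < u j) → StrictMono u →
    ∑ j ∈ range (m + 1), j + 1 ≤ (fimg m u {0, 1}).card := by
  induction m with
  | zero =>
    intro u _ _
    have : (0 : ℤ) ∈ fimg 0 u {0, 1} := by
      rw [mem_fimg_iff]; exact ⟨fun _ => 0, by simp, by simp⟩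
    simpa using Finset.card_pos.mpr ⟨_, this⟩
  | succ m ih =>
    intro u hu hmono
    have h1 := ih (fun j => u j.castSucc) (fun j => hu _)
      (fun i j hij => hmono (by simpa using hij))
    set W : ℤ := ∑ j, u j with hW
    have hWs : W = ∑ j : Fin m, u j.castSucc + u (Fin.last m) := Fin.sum_univ_castSucc _
    set T : Finset ℤ := insert W (univ.image (fun j : Fin m => W - u j.castSucc)) with hT
    have hTc : T.card = m + 1 := by
      rw [hT, card_insert_of_notMem, card_image_of_injective]
      · simp
      · intro i j hij
        have : u i.castSucc = u j.castSucc := by simpa using hij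
        exact Fin.castSucc_injective _ (hmono.injective this)
      · simp only [mem_image, mem_univ, true_and, not_exists]
        intro j hj
        have := hu j.castSucc
        lia
    have hTgt : ∀ z ∈ T, ∑ j : Fin m, u j.castSucc < z := by
      intro z hz
      rw [hT, mem_insert, mem_image] at hz
      rcases hz with rfl | ⟨j, _, rfl⟩
      · have := hu (Fin.last m)
        lia
      · have := hmono (Fin.castSucc_lt_last j)
        lia
    have hold : ∀ z ∈ fimg m (fun j => u j.castSucc) {0, 1}, z ≤ ∑ j : Fin m, u j.castSucc := by
      intro z hz
      rw [mem_fimg_iff] at hz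
      obtain ⟨x, hx, rfl⟩ := hz
      apply sum_le_sum
      intro j _
      have := hu j.castSucc
      have hxj := hx j
      simp only [mem_insert, mem_singleton] at hxj
      rcases hxj with h | h <;> rw [h] <;> lia
    have hdisj : Disjoint (fimg m (fun j => u j.castSucc) {0, 1}) T := by
      rw [Finset.disjoint_left]
      intro z h1 h2
      have := hTgt z h2
      have := hold z h1
      lia
    have hsub : fimg m (fun j => u j.castSucc) {0, 1} ∪ T ⊆ fimg (m + 1) u {0, 1} := by
      intro z hz
      rw [mem_fimg_iff]
      rw [mem_union] at hz
      rcases hz with hz | hz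
      · rw [mem_fimg_iff] at hz
        obtain ⟨x, hx, rfl⟩ := hz
        refine ⟨Fin.snoc (α := fun _ => ℤ) x 0, ?_, ?_⟩
        · intro j
          refine Fin.lastCases ?_ ?_ j
          · simp
          · intro i; simpa using hx i
        · rw [Fin.sum_univ_castSucc]; simp
      · rw [hT, mem_insert, mem_image] at hz
        rcases hz with rfl | ⟨j, _, rfl⟩
        · exact ⟨fun _ => 1, by simp, by simp [hW]⟩
        · refine ⟨fun i => if i = j.castSucc then 0 else 1, ?_, ?_⟩
          · intro i; dsimp only; split_ifs <;> simp
          · have : ∀ i, u i * (if i = j.castSucc then (0 : ℤ) else 1)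
                = u i - (if i = j.castSucc then u i else 0) := by
              intro i; split_ifs <;> simp
            simp [this, hW]
    have := card_le_card hsub
    rw [card_union_of_disjoint hdisj, hTc] at this
    rw [sum_range_succ]
    lia

lemma fimg_lower (m : ℕ) (u : Fin m → ℤ) (hu : ∀ j, 0 < u j) (hmono : StrictMono u)
    (A : Finset ℤ) : A.Nonempty →
    (∑ j ∈ range (m + 1), j) * (A.card - 1) + 1 ≤ (fimg m u A).card := by
  have hsum : ∀ a : ℤ, ∑ j, u j * a = (∑ j, u j) * a := fun a => (sum_mul _ _ _).symm
  induction A using Finset.induction_on_max with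
  | empty => intro h; simp at h
  | insert b A hb ih =>
    intro _
    rcases A.eq_empty_or_nonempty with rfl | hA
    · have : ∑ j, u j * b ∈ fimg m u (insert b ∅) := by
        rw [mem_fimg_iff]; exact ⟨fun _ => b, by simp, rfl⟩
      simpa using Finset.card_pos.mpr ⟨_, this⟩
    · have ih := ih hA
      have hbA : b ∉ A := fun h => lt_irrefl _ (hb b h)
      rw [card_insert_of_notMem hbA]
      set a := A.max' hA with ha
      have haA : a ∈ A := A.max'_mem hA
      have hab : a < b := hb a haA
      set P := (fimg m u {0, 1}).filter (fun s => 0 < s) with hP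
      have hPc : ∑ j ∈ range (m + 1), j ≤ P.card := by
        have h1 := subset_sums m u hu hmono
        have h2 : fimg m u {0, 1} ⊆ insert 0 P := by
          intro z hz
          rw [mem_insert, hP, mem_filter]
          have : 0 ≤ z := by
            obtain ⟨x, hx, rfl⟩ := (mem_fimg_iff _ _ _ _).1 hz
            apply sum_nonneg
            intro j _
            apply mul_nonneg (hu j).le
            have := hx j
            simp only [mem_insert, mem_singleton] at this
            lia
          rcases this.eq_or_lt with h | h
          · exact Or.inl h.symm
          · exact Or.inr ⟨hz, h⟩
        have h3 := card_le_card h2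
        have h4 := card_insert_le 0 P
        lia
      set Q := P.image (fun s => (∑ j, u j) * a + (b - a) * s) with hQ
      have hQc : Q.card = P.card := by
        apply card_image_of_injective
        intro s t hst
        have h : (b - a) * s = (b - a) * t := by simpa using hst
        exact mul_left_cancel₀ (by lia) h
      have hdisj : Disjoint (fimg m u A) Q := by
        rw [Finset.disjoint_left]
        intro z h1 h2
        obtain ⟨x, hx, rfl⟩ := (mem_fimg_iff _ _ _ _).1 h1
        rw [hQ, mem_image] at h2
        obtain ⟨s, hs, hs2⟩ := h2
        have hs0 : 0 < s := (mem_filter.1 hs).2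
        have h3 : 0 < (b - a) * s := mul_pos (by lia) hs0
        have h4 : ∑ j, u j * x j ≤ ∑ j, u j * a :=
          sum_le_sum fun j _ => mul_le_mul_of_nonneg_left (A.le_max' _ (hx j)) (hu j).le
        rw [hsum] at h4
        lia
      have hsub : fimg m u A ∪ Q ⊆ fimg m u (insert b A) := by
        intro z hz
        rw [mem_fimg_iff]
        rcases mem_union.1 hz with hz | hz
        · obtain ⟨x, hx, rfl⟩ := (mem_fimg_iff _ _ _ _).1 hz
          exact ⟨x, fun j => mem_insert_of_mem (hx j), rfl⟩
        · obtain ⟨s, hs, rfl⟩ := mem_image.1 hz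
          obtain ⟨x, hx, rfl⟩ := (mem_fimg_iff _ _ _ _).1 (mem_filter.1 hs).1
          refine ⟨fun j => a + (b - a) * x j, ?_, ?_⟩
          · intro j
            have := hx j
            simp only [mem_insert, mem_singleton] at this
            rcases this with h | h
            · simp [h, haA]
            · simp [h]
          · rw [← hsum, mul_sum, ← sum_add_distrib]
            exact sum_congr rfl fun j _ => by ring
      have h5 := card_le_card hsub
      rw [card_union_of_disjoint hdisj, hQc] at h5
      have h6 : A.card = (A.card - 1) + 1 := by
        have := hA.card_pos
        lia
      have h7 : A.card + 1 - 1 = (A.card - 1) + 1 := by lia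
      rw [h7, mul_add]
      lia

lemma value_eq (m k : ℕ) (hm : 0 < m) (hk : 0 < k) :
    (m ^ 2 + m) / 2 * k - (m ^ 2 + m - 2) / 2 = (∑ j ∈ range (m + 1), j) * (k - 1) + 1 := by
  have h := Finset.sum_range_id_mul_two (m + 1)
  have h2 : m ^ 2 + m = (∑ j ∈ range (m + 1), j) * 2 := by
    rw [h]; simp; ring
  have h3 : 0 < m ^ 2 + m := by positivity
  rw [h2] at h3 ⊢
  generalize (∑ j ∈ range (m + 1), j) = S at *
  obtain ⟨k, rfl⟩ : ∃ l, k = l + 1 := ⟨k - 1, by lia⟩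
  have h4 : (S * 2 - 2) / 2 = S - 1 := by lia
  rw [h4, Nat.mul_div_cancel _ (by norm_num), mul_add]
  simp only [Nat.add_sub_cancel]
  lia

lemma Nf_lower (m k : ℕ) (hk : 0 < k) (u : Fin m → ℤ) (hu : ∀ j, 0 < u j)
    (hmono : StrictMono u) : (∑ j ∈ range (m + 1), j) * (k - 1) + 1 ≤ Nf m u k := by
  have hne : {n : ℕ | ∃ A : Finset ℤ, A.card = k ∧ (fimg m u A).card = n}.Nonempty :=
    ⟨_, (Finset.range k).image (fun i : ℕ => (i : ℤ)), by
      rw [card_image_of_injective _ Nat.cast_injective, card_range], rfl⟩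
  obtain ⟨A, hA, h⟩ := Nat.sInf_mem hne
  have h' : (fimg m u A).card = Nf m u k := h
  rw [← h', ← hA]
  exact fimg_lower m u hu hmono A (card_pos.1 (by lia))

lemma fimg_upper (m k : ℕ) (hk : 0 < k) :
    (fimg m (fun j => (j : ℤ) + 1) ((Finset.range k).image fun i : ℕ => (i : ℤ))).card
      ≤ (∑ j ∈ range (m + 1), j) * (k - 1) + 1 := by
  have hsub : fimg m (fun j => (j : ℤ) + 1) ((Finset.range k).image fun i : ℕ => (i : ℤ))
      ⊆ Finset.Icc (0 : ℤ) (((∑ j ∈ range (m + 1), j) * (k - 1) : ℕ) : ℤ) := by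
    intro z hz
    obtain ⟨x, hx, rfl⟩ := (mem_fimg_iff _ _ _ _).1 hz
    have hx' : ∀ j, 0 ≤ x j ∧ x j ≤ ((k - 1 : ℕ) : ℤ) := by
      intro j
      obtain ⟨i, hi, hi2⟩ := mem_image.1 (hx j)
      rw [mem_range] at hi
      lia
    have hS : (((∑ j ∈ range (m + 1), j : ℕ)) : ℤ) = ∑ j : Fin m, ((j : ℤ) + 1) := by
      rw [sum_range_succ', ← Fin.sum_univ_eq_sum_range (fun i => i + 1)]
      push_cast
      simp
    rw [mem_Icc]
    constructor
    · exact sum_nonneg fun j _ => mul_nonneg (by positivity) (hx' j).1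
    · rw [Nat.cast_mul, hS, sum_mul]
      exact sum_le_sum fun j _ => mul_le_mul_of_nonneg_left (hx' j).2 (by positivity)
  have h := card_le_card hsub
  rw [Int.card_Icc] at h
  lia

theorem stmt3 (m k : ℕ) (hm : 0 < m) (hk : 0 < k) :
    IsLeast {n : ℕ | ∃ u : Fin m → ℤ, (∀ j, 0 < u j) ∧ StrictMono u ∧ Nf m u k = n}
      ((m ^ 2 + m) / 2 * k - (m ^ 2 + m - 2) / 2) ∧
    Nf m (fun j => (j : ℤ) + 1) k = (m ^ 2 + m) / 2 * k - (m ^ 2 + m - 2) / 2 ∧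
    (fimg m (fun j => (j : ℤ) + 1) ((Finset.range k).image fun i : ℕ => (i : ℤ))).card
      = (m ^ 2 + m) / 2 * k - (m ^ 2 + m - 2) / 2 := by
  rw [value_eq m k hm hk]
  have hu : ∀ j : Fin m, 0 < (j : ℤ) + 1 := fun j => by positivity
  have hmono : StrictMono (fun j : Fin m => (j : ℤ) + 1) := by
    intro i j hij
    have : (i : ℕ) < (j : ℕ) := hij
    dsimp only
    lia
  have hcard : ((Finset.range k).image fun i : ℕ => (i : ℤ)).card = k := by
    rw [card_image_of_injective _ Nat.cast_injective, card_range]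
  have hlow := Nf_lower m k hk _ hu hmono
  have hup := fimg_upper m k hk
  have hN : Nf m (fun j => (j : ℤ) + 1) k ≤
      (fimg m (fun j => (j : ℤ) + 1) ((Finset.range k).image fun i : ℕ => (i : ℤ))).card :=
    Nat.sInf_le ⟨_, hcard, rfl⟩
  have hNeq := le_antisymm (hN.trans hup) hlow
  refine ⟨⟨⟨_, hu, hmono, hNeq⟩, ?_⟩, hNeq, le_antisymm hup (hlow.trans hN)⟩
  rintro n ⟨u, hu, hm, rfl⟩
  exact Nf_lower m k hk u hu hm
end

section
/- Let f(x_1,...,x_m) = u_1x_1 + ⋯ + u_mx_m be an m-ary linear form with positive integer coefficients satisfying 1 ≤ u_1 < u_2 < ⋯ < u_m. Then N_f(2) ≥ (m² + m + 2)/2; that is, for any two distinct integers a < b, the set f({a,b}) has at least (m² + m + 2)/2 elements. -/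
open Finset

theorem mem_fimg_pair (m : ℕ) (u : Fin m → ℤ) (a b y : ℤ) :
    y ∈ fimg m u {a, b} ↔ ∃ x : Fin m → ℤ, (∀ j, x j = a ∨ x j = b) ∧ ∑ j, u j * x j = y := by
  simp [fimg, Fintype.mem_piFinset]

theorem fimg_pair_card (a b : ℤ) (hab : a < b) (m : ℕ) : ∀ (u : Fin m → ℤ), (∀ j, 0 < u j) →
    StrictMono u → m ^ 2 + m + 2 ≤ 2 * (fimg m u {a, b}).card := by
  induction m with
  | zero =>
    intro u _ _
    have : 0 < (fimg 0 u {a, b}).card := by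
      apply Finset.card_pos.mpr
      refine ⟨0, (mem_fimg_pair _ _ _ _ _).mpr ⟨fun _ => a, fun _ => Or.inl rfl, by simp⟩⟩
    omega
  | succ m ih =>
    intro u hu hmono
    have h1 := ih (fun j => u j.castSucc) (fun j => hu _)
      (fun i j hij => hmono (Fin.castSucc_lt_castSucc_iff.mpr hij))
    set S := fimg m (fun j => u j.castSucc) {a, b} with hS
    set T : ℤ := ∑ j, u j with hT
    have hTs : T = ∑ j : Fin m, u j.castSucc + u (Fin.last m) := Fin.sum_univ_castSucc _
    set P := S.image (fun y => y + u (Fin.last m) * a) with hP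
    set Q := (Finset.univ : Finset (Fin m)).image (fun j => T * b - (b - a) * u j.castSucc) with hQ
    have hPc : P.card = S.card := Finset.card_image_of_injective _ (add_left_injective _)
    have hQc : Q.card = m := by
      rw [hQ, Finset.card_image_of_injective, Finset.card_univ, Fintype.card_fin]
      intro i j hij
      have h2 : (b - a) * u i.castSucc = (b - a) * u j.castSucc := by
        simp only at hij; linarith
      have h3 := mul_left_cancel₀ (by omega : b - a ≠ 0) h2
      exact Fin.castSucc_injective _ (hmono.injective h3)
    have hnot : T * b ∉ Q := by
      simp only [hQ, Finset.mem_image, Finset.mem_univ, true_and, not_exists]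
      intro j hj
      have := mul_pos (sub_pos.mpr hab) (hu j.castSucc)
      linarith
    have hPle : ∀ y ∈ P, y ≤ T * b - (b - a) * u (Fin.last m) := by
      intro y hy
      obtain ⟨z, hz, rfl⟩ := Finset.mem_image.mp hy
      obtain ⟨x, hx, rfl⟩ := (mem_fimg_pair _ _ _ _ _).mp hz
      have : ∑ j : Fin m, u j.castSucc * x j ≤ ∑ j : Fin m, u j.castSucc * b := by
        apply Finset.sum_le_sum
        intro j _
        apply mul_le_mul_of_nonneg_left _ (hu _).le
        rcases hx j with h | h <;> omega
      rw [← Finset.sum_mul] at this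
      rw [hTs]
      linarith
    have hdisj : Disjoint P (insert (T * b) Q) := by
      rw [Finset.disjoint_left]
      intro y hy hy2
      have h2 := hPle y hy
      rcases Finset.mem_insert.mp hy2 with rfl | h3
      · have := mul_pos (sub_pos.mpr hab) (hu (Fin.last m))
        linarith
      · obtain ⟨j, _, rfl⟩ := Finset.mem_image.mp h3
        have := mul_lt_mul_of_pos_left (hmono (Fin.castSucc_lt_last j)) (sub_pos.mpr hab)
        linarith
    have hsub : P ∪ insert (T * b) Q ⊆ fimg (m + 1) u {a, b} := by
      intro y hy
      rw [mem_fimg_pair]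
      rcases Finset.mem_union.mp hy with h | h
      · obtain ⟨z, hz, rfl⟩ := Finset.mem_image.mp h
        obtain ⟨x, hx, rfl⟩ := (mem_fimg_pair _ _ _ _ _).mp hz
        refine ⟨Fin.snoc x a, ?_, ?_⟩
        · intro j
          refine Fin.lastCases ?_ (fun i => ?_) j
          · simp
          · simpa using hx i
        · rw [Fin.sum_univ_castSucc]
          simp
      · rcases Finset.mem_insert.mp h with rfl | h3
        · exact ⟨fun _ => b, fun _ => Or.inr rfl, by rw [hT, Finset.sum_mul]⟩
        · obtain ⟨j, _, rfl⟩ := Finset.mem_image.mp h3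
          refine ⟨fun i => b - if i = j.castSucc then b - a else 0, ?_, ?_⟩
          · intro i
            by_cases hi : i = j.castSucc <;> simp [hi]
          · simp only [mul_sub, Finset.sum_sub_distrib, mul_ite, mul_zero]
            simp [← Finset.sum_mul, hT]
            ring
    have hc := Finset.card_le_card hsub
    rw [Finset.card_union_of_disjoint hdisj, Finset.card_insert_of_notMem hnot, hPc, hQc] at hc
    nlinarith

theorem stmt4 (m : ℕ) (hm : 0 < m) (u : Fin m → ℤ) (hu : ∀ j, 0 < u j)
    (hmono : StrictMono u) :
    (m ^ 2 + m + 2) / 2 ≤ Nf m u 2 ∧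
    ∀ a b : ℤ, a < b → (m ^ 2 + m + 2) / 2 ≤ (fimg m u {a, b}).card := by
  have key : ∀ a b : ℤ, a < b → (m ^ 2 + m + 2) / 2 ≤ (fimg m u {a, b}).card := by
    intro a b hab
    have := fimg_pair_card a b hab m u hu hmono
    omega
  refine ⟨?_, key⟩
  unfold Nf
  apply le_csInf
  · exact ⟨_, {0, 1}, by simp, rfl⟩
  · rintro n ⟨A, hA, rfl⟩
    obtain ⟨x, y, hxy, rfl⟩ := Finset.card_eq_two.mp hA
    rcases lt_or_gt_of_ne hxy with h | h
    · exact key x y h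
    · rw [Finset.pair_comm]
      exact key y x h
end

section
/- For the binary linear form f(x_1,x_2) = x_1 + 2x_2, one has N_f(k) = 3k − 2 for every positive integer k. -/
open Finset

open scoped Pointwise in
lemma aux_lower (n : ℕ) : ∀ A : Finset ℤ, A.Nonempty → (∀ a ∈ A, ∀ b ∈ A, a - b ≤ n) →
    3 * A.card ≤ (A + A.image (fun x => 2 * x)).card + 2 := by
  have hinj : Function.Injective (fun x : ℤ => 2 * x) := fun x y h => by
    simp only at h; omega
  induction n using Nat.strong_induction_on with
  | _ n ih =>
  intro A hA hd
  have hA2 : (A.image (fun x => 2 * x)).Nonempty := hA.image _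
  have hc2 : (A.image (fun x => 2 * x)).card = A.card := card_image_of_injective _ hinj
  by_cases hs : ∃ r : ℤ, ∀ a ∈ A, a % 2 = r
  · obtain ⟨r, hr⟩ := hs
    rcases Nat.eq_zero_or_pos n with h0 | hpos
    · have h1 : A.card ≤ 1 := card_le_one.2 fun a ha b hb => by
        have := hd a ha b hb
        have := hd b hb a ha
        omega
      have h2 : 0 < (A + A.image (fun x => 2 * x)).card := card_pos.2 (hA.add hA2)
      omega
    · set B := A.image (fun x => x / 2) with hB
      have hBc : B.card = A.card := card_image_of_injOn fun a ha b hb h => by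
        have := hr a ha
        have := hr b hb
        have h' : a / 2 = b / 2 := h
        omega
      have h3 := ih (n / 2) (by omega) B (hA.image _) (by
        intro a ha b hb
        obtain ⟨x, hx, rfl⟩ := mem_image.1 ha
        obtain ⟨y, hy, rfl⟩ := mem_image.1 hb
        have := hr x hx
        have := hr y hy
        have := hd x hx y hy
        push_cast
        omega)
      have h4 : (B + B.image (fun x => 2 * x)).card ≤ (A + A.image (fun x => 2 * x)).card := by
        apply card_le_card_of_injOn (fun x => 2 * x + 3 * r)
        · intro z hz
          obtain ⟨p, hp, q, hq, rfl⟩ := mem_add.1 (mem_coe.1 hz)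
          obtain ⟨q', hq', rfl⟩ := mem_image.1 hq
          obtain ⟨x, hx, rfl⟩ := mem_image.1 hp
          obtain ⟨y, hy, rfl⟩ := mem_image.1 hq'
          have := hr x hx
          have := hr y hy
          refine mem_coe.2 (mem_add.2 ⟨x, hx, 2 * y, mem_image_of_mem _ hy, ?_⟩)
          simp only
          omega
        · intro x _ y _ h
          simp only at h
          omega
      omega
  · push Not at hs
    obtain ⟨a, ha, ha'⟩ := hs 1
    obtain ⟨b, hb, hb'⟩ := hs 0
    have hc := card_filter_add_card_filter_not (s := A) (fun x => x % 2 = 0)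
    have e0 : (A.filter (fun x => x % 2 = 0)).Nonempty := ⟨a, mem_filter.2 ⟨ha, by omega⟩⟩
    have e1 : (A.filter (fun x => ¬ x % 2 = 0)).Nonempty := ⟨b, mem_filter.2 ⟨hb, hb'⟩⟩
    have c0 := cauchy_davenport_add_of_linearOrder_isCancelAdd e0 hA2
    have c1 := cauchy_davenport_add_of_linearOrder_isCancelAdd e1 hA2
    have hdis : Disjoint (A.filter (fun x => x % 2 = 0) + A.image (fun x => 2 * x))
        (A.filter (fun x => ¬ x % 2 = 0) + A.image (fun x => 2 * x)) := by
      rw [Finset.disjoint_left]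
      intro z hz hz'
      obtain ⟨p, hp, q, hq, rfl⟩ := mem_add.1 hz
      obtain ⟨p', hp', q', hq', h⟩ := mem_add.1 hz'
      obtain ⟨q, hq, rfl⟩ := mem_image.1 hq
      obtain ⟨q', hq', rfl⟩ := mem_image.1 hq'
      have := (mem_filter.1 hp).2
      have := (mem_filter.1 hp').2
      omega
    have hu := card_union_of_disjoint hdis
    rw [← union_add, filter_union_filter_not_eq] at hu
    have := e0.card_pos
    have := e1.card_pos
    omega

open scoped Pointwise in
lemma fimg_eq (A : Finset ℤ) : fimg 2 ![1, 2] A = A + A.image (fun x => 2 * x) := by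
  ext z
  simp only [fimg, mem_image, Fintype.mem_piFinset, mem_add, Fin.sum_univ_two, Fin.forall_fin_two]
  constructor
  · rintro ⟨x, ⟨h0, h1⟩, rfl⟩
    exact ⟨x 0, h0, _, ⟨x 1, h1, rfl⟩, by simp⟩
  · rintro ⟨x, hx, _, ⟨y, hy, rfl⟩, rfl⟩
    exact ⟨![x, y], ⟨by simpa using hx, by simpa using hy⟩, by simp⟩

theorem stmt6 (k : ℕ) (hk : 0 < k) : Nf 2 ![1, 2] k = 3 * k - 2 := by
  have low : ∀ A : Finset ℤ, A.card = k → 3 * k - 2 ≤ (fimg 2 ![1, 2] A).card := by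
    intro A hA
    have hne : A.Nonempty := card_pos.1 (by omega)
    have := aux_lower (A.max' hne - A.min' hne).toNat A hne (by
      intro a ha b hb
      have := A.le_max' a ha
      have := A.min'_le b hb
      omega)
    rw [fimg_eq]
    omega
  have hcard : (Finset.Ico (0 : ℤ) k).card = k := by simp
  have hup : (fimg 2 ![1, 2] (Finset.Ico (0 : ℤ) k)).card ≤ 3 * k - 2 := by
    have hsub : fimg 2 ![1, 2] (Finset.Ico (0 : ℤ) k) ⊆ Finset.Ico (0 : ℤ) (3 * k - 2) := by
      rw [fimg_eq]
      intro z hz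
      obtain ⟨p, hp, q, hq, rfl⟩ := mem_add.1 hz
      obtain ⟨q, hq, rfl⟩ := mem_image.1 hq
      rw [Finset.mem_Ico] at *
      omega
    have := card_le_card hsub
    rw [Int.card_Ico] at this
    omega
  have hmem : (fimg 2 ![1, 2] (Finset.Ico (0 : ℤ) k)).card ∈
      {n : ℕ | ∃ A : Finset ℤ, A.card = k ∧ (fimg 2 ![1, 2] A).card = n} := ⟨_, hcard, rfl⟩
  apply le_antisymm
  · exact (Nat.sInf_le hmem).trans hup
  · apply le_csInf ⟨_, hmem⟩
    rintro n ⟨A, hA, rfl⟩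
    exact low A hA
end

section
/- Let f(x_1,x_2) = u_1x_1 + u_2x_2 be a binary linear form with positive integer coefficients satisfying 1 ≤ u_1 < u_2 and gcd(u_1,u_2) = 1. If (u_1,u_2) ≠ (1,1) and (u_1,u_2) ≠ (1,2), then N_f(k) ≥ ⌊(7k − 5)/2⌋ for every positive integer k. -/
open Finset

open scoped Pointwise

lemma cd_aux (X Y : Finset ℤ) (hX : X.Nonempty) (hY : Y.Nonempty) :
    X.card + Y.card ≤ (X + Y).card + 1 := by
  have := cauchy_davenport_add_of_linearOrder_isCancelAdd hX hY
  omega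

/-- Number of residue classes met. -/
def ncl (m : ℤ) (X : Finset ℤ) : ℕ := (X.image (fun x => x % m)).card

lemma cls_aux (m : ℤ) (X Y : Finset ℤ) (hY : Y.Nonempty)
    (hYm : ∀ y ∈ Y, ∀ y' ∈ Y, m ∣ y - y') :
    X.card + ncl m X * Y.card ≤ (X + Y).card + ncl m X := by
  classical
  set R := X.image (fun x => x % m) with hR
  have e1 : X.card = ∑ r ∈ R, (X.filter (fun x => x % m = r)).card :=
    Finset.card_eq_sum_card_image _ _
  have e2 : (R.biUnion (fun r => X.filter (fun x => x % m = r) + Y)).card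
      = ∑ r ∈ R, (X.filter (fun x => x % m = r) + Y).card := by
    apply Finset.card_biUnion
    intro r _ s _ hrs
    change Disjoint (X.filter (fun x => x % m = r) + Y) (X.filter (fun x => x % m = s) + Y)
    rw [Finset.disjoint_left]
    intro z hz hz'
    rw [Finset.mem_add] at hz hz'
    obtain ⟨x, hx, y, hy, rfl⟩ := hz
    obtain ⟨x', hx', y', hy', h⟩ := hz'
    simp only [Finset.mem_filter] at hx hx'
    apply hrs
    rw [← hx.2, ← hx'.2]
    rw [Int.emod_eq_emod_iff_emod_sub_eq_zero]
    apply Int.emod_eq_zero_of_dvd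
    have := hYm y' hy' y hy
    have h2 : x - x' = y' - y := by linarith
    rwa [h2]
  have e3 : (R.biUnion (fun r => X.filter (fun x => x % m = r) + Y)).card ≤ (X + Y).card := by
    apply Finset.card_le_card
    intro z hz
    rw [Finset.mem_biUnion] at hz
    obtain ⟨r, _, hz⟩ := hz
    exact Finset.add_subset_add_right (Finset.filter_subset _ _) hz
  have e4 : ∑ r ∈ R, ((X.filter (fun x => x % m = r)).card + Y.card)
      ≤ ∑ r ∈ R, ((X.filter (fun x => x % m = r) + Y).card + 1) := by
    apply Finset.sum_le_sum
    intro r hr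
    apply cd_aux _ _ _ hY
    obtain ⟨x, hx, hxr⟩ := Finset.mem_image.1 hr
    exact ⟨x, by simp [hx, hxr]⟩
  rw [Finset.sum_add_distrib, Finset.sum_add_distrib, ← e1, ← e2] at e4
  simp only [Finset.sum_const, smul_eq_mul, mul_one] at e4
  unfold ncl
  rw [← hR]
  omega

lemma cls_le (m : ℤ) (t : ℕ) (X Y : Finset ℤ) (hY : Y.Nonempty)
    (hYm : ∀ y ∈ Y, ∀ y' ∈ Y, m ∣ y - y') (ht : t ≤ ncl m X) :
    X.card + t * Y.card ≤ (X + Y).card + t := by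
  have h := cls_aux m X Y hY hYm
  have h1 : 1 ≤ Y.card := hY.card_pos
  nlinarith

lemma ncl_two (m : ℤ) (X : Finset ℤ) (a b : ℤ) (ha : a ∈ X) (hb : b ∈ X) (h : ¬ m ∣ a - b) :
    2 ≤ ncl m X := by
  unfold ncl
  have : ({a % m, b % m} : Finset ℤ).card = 2 := by
    apply Finset.card_pair
    intro e
    exact h (Int.ModEq.dvd (show b ≡ a [ZMOD m] from e.symm))
  rw [← this]
  apply Finset.card_le_card
  intro z hz
  simp only [Finset.mem_insert, Finset.mem_singleton] at hz
  rcases hz with rfl | rfl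
  · exact Finset.mem_image_of_mem _ ha
  · exact Finset.mem_image_of_mem _ hb

lemma ncl_three (m : ℤ) (X : Finset ℤ) (a b c : ℤ) (ha : a ∈ X) (hb : b ∈ X) (hc : c ∈ X)
    (h : ¬ m ∣ a - b) (h' : ¬ m ∣ a - c) (h'' : ¬ m ∣ b - c) :
    3 ≤ ncl m X := by
  unfold ncl
  have key : ∀ x y : ℤ, ¬ m ∣ x - y → x % m ≠ y % m := fun x y hxy e =>
    hxy (Int.ModEq.dvd (show y ≡ x [ZMOD m] from e.symm))
  have : ({a % m, b % m, c % m} : Finset ℤ).card = 3 :=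
    Finset.card_eq_three.2 ⟨_, _, _, key _ _ h, key _ _ h', key _ _ h'', rfl⟩
  rw [← this]
  apply Finset.card_le_card
  intro z hz
  simp only [Finset.mem_insert, Finset.mem_singleton] at hz
  rcases hz with rfl | rfl | rfl
  · exact Finset.mem_image_of_mem _ ha
  · exact Finset.mem_image_of_mem _ hb
  · exact Finset.mem_image_of_mem _ hc

/-- If `B` meets at least two classes, bound `|B + (A1 ∪ A2)|`. -/
lemma multi_aux (m d : ℤ) (hd : ¬ m ∣ d) (hd2 : ¬ m ∣ 2 * d) (B A1 A2 : Finset ℤ)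
    (h1 : A1.Nonempty) (h2 : A2.Nonempty) (hB : B.Nonempty)
    (hA1 : ∀ y ∈ A1, ∀ y' ∈ A1, m ∣ y - y') (hA12 : ∀ y ∈ A1, ∀ y' ∈ A2, m ∣ y' - y - d)
    (hB2 : 2 ≤ ncl m B) :
    (B.card + 2 * A1.card + A2.card ≤ (B + (A1 ∪ A2)).card + 2) ∨
    (B.card + 3 * A1.card ≤ (B + (A1 ∪ A2)).card + 3 ∧ 3 ≤ B.card) := by
  have hsub : B + A1 ⊆ B + (A1 ∪ A2) := Finset.add_subset_add_left Finset.subset_union_left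
  by_cases hc : ∀ b ∈ B, ∃ b' ∈ B, m ∣ b' - b - d
  · right
    obtain ⟨b, hb⟩ := hB
    obtain ⟨b', hb', e1⟩ := hc b hb
    obtain ⟨b'', hb'', e2⟩ := hc b' hb'
    have h3 : 3 ≤ ncl m B := by
      apply ncl_three m B b'' b' b hb'' hb' hb
      · intro h; apply hd
        have := dvd_sub h e2
        have e : b'' - b' - (b'' - b' - d) = d := by ring
        rwa [e] at this
      · intro h; apply hd2
        have := dvd_sub h (dvd_add e2 e1)
        have e : b'' - b - (b'' - b' - d + (b' - b - d)) = 2 * d := by ring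
        rwa [e] at this
      · intro h; apply hd
        have := dvd_sub h e1
        have e : b' - b - (b' - b - d) = d := by ring
        rwa [e] at this
    refine ⟨?_, h3.trans Finset.card_image_le⟩
    have := cls_le m 3 B A1 h1 hA1 h3
    have := Finset.card_le_card hsub
    omega
  · left
    push Not at hc
    obtain ⟨b, hb, hbn⟩ := hc
    have := cls_le m 2 B A1 h1 hA1 hB2
    have hdis : Disjoint (B + A1) ({b} + A2) := by
      rw [Finset.disjoint_left]
      intro z hz hz'
      rw [Finset.mem_add] at hz hz'
      obtain ⟨x, hx, y, hy, rfl⟩ := hz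
      obtain ⟨x', hx', y', hy', h⟩ := hz'
      rw [Finset.mem_singleton] at hx'
      subst hx'
      apply hbn x hx
      have := hA12 y hy y' hy'
      have e : x - x' - d = y' - y - d := by linarith
      rwa [e]
    have hle : ((B + A1) ∪ ({b} + A2)).card ≤ (B + (A1 ∪ A2)).card := by
      apply Finset.card_le_card
      apply Finset.union_subset hsub
      exact Finset.add_subset_add (by simpa using hb) Finset.subset_union_right
    rw [Finset.card_union_of_disjoint hdis] at hle
    have h0 : ({b} + A2).card = A2.card := by
      rw [Finset.singleton_add]; exact Finset.card_image_of_injective _ (add_right_injective b)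
    omega

lemma core_aux (m d : ℤ) (hd : ¬ m ∣ d) (hd2 : ¬ m ∣ 2 * d) (B1 B2 A1 A2 : Finset ℤ)
    (h1 : A1.Nonempty) (h2 : A2.Nonempty) (c1 : B1.card = A1.card) (c2 : B2.card = A2.card)
    (hA1 : ∀ y ∈ A1, ∀ y' ∈ A1, m ∣ y - y') (hA12 : ∀ y ∈ A1, ∀ y' ∈ A2, m ∣ y' - y - d)
    (hle : A2.card ≤ A1.card) :
    7 * (A1.card + A2.card) ≤ 2 * ((B1 + (A1 ∪ A2)).card + (B2 + (A1 ∪ A2)).card) + 6 := by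
  have p1 := h1.card_pos
  have p2 := h2.card_pos
  have hB1 : B1.Nonempty := Finset.card_pos.1 (by omega)
  have hB2 : B2.Nonempty := Finset.card_pos.1 (by omega)
  have hdisj : Disjoint A1 A2 := by
    rw [Finset.disjoint_left]
    intro z hz hz'
    apply hd
    have := hA12 z hz z hz'
    simpa using this
  have hcard := Finset.card_union_of_disjoint hdisj
  obtain ⟨x, hx⟩ := h1
  obtain ⟨y, hy⟩ := h2
  have hAA : 2 ≤ ncl m (A1 ∪ A2) := by
    apply ncl_two m _ y x (Finset.mem_union_right _ hy) (Finset.mem_union_left _ hx)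
    intro h; apply hd
    have := dvd_sub h (hA12 x hx y hy)
    have e : y - x - (y - x - d) = d := by ring
    rwa [e] at this
  have one : ∀ B : Finset ℤ, B.Nonempty → ¬ 2 ≤ ncl m B →
      A1.card + A2.card + 2 * B.card ≤ (B + (A1 ∪ A2)).card + 2 := by
    intro B hB hn
    rw [add_comm B, ← hcard]
    apply cls_le m 2 _ _ hB _ hAA
    intro y hy y' hy'
    by_contra h
    exact hn (ncl_two m B y y' hy hy' h)
  have multi := fun B hB h => multi_aux m d hd hd2 B A1 A2 ⟨x, hx⟩ ⟨y, hy⟩ hB hA1 hA12 h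
  by_cases q1 : 2 ≤ ncl m B1
  · have m1 := multi B1 hB1 q1
    by_cases q2 : 2 ≤ ncl m B2
    · have m2 := multi B2 hB2 q2
      omega
    · have m2 := one B2 hB2 q2
      omega
  · have m1 := one B1 hB1 q1
    have m2 := cd_aux B2 (A1 ∪ A2) hB2 ⟨x, Finset.mem_union_left _ hx⟩
    omega

/-- The image set as a sumset. -/
def FF (u1 u2 : ℤ) (A B : Finset ℤ) : Finset ℤ :=
  A.image (fun x => u1 * x) + B.image (fun x => u2 * x)

lemma card_dil (u : ℤ) (hu : u ≠ 0) (A : Finset ℤ) : (A.image (fun x => u * x)).card = A.card :=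
  Finset.card_image_of_injective _ (mul_right_injective₀ hu)

lemma exists_quot (m r : ℤ) (hm : m ≠ 0) (A : Finset ℤ) (h : ∀ a ∈ A, m ∣ a - r) :
    ∃ B : Finset ℤ, A = B.image (fun x => r + m * x) ∧ B.card = A.card := by
  have hA : A = (A.image (fun a => (a - r) / m)).image (fun x => r + m * x) := by
    rw [Finset.image_image]
    ext z
    simp only [Finset.mem_image, Function.comp]
    constructor
    · intro hz
      exact ⟨z, hz, by rw [Int.mul_ediv_cancel' (h z hz)]; ring⟩
    · rintro ⟨a, ha, rfl⟩
      rw [Int.mul_ediv_cancel' (h a ha)]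
      simpa using ha
  refine ⟨A.image (fun a => (a - r) / m), hA, ?_⟩
  conv_rhs => rw [hA]
  symm
  apply Finset.card_image_of_injective
  intro x y hxy
  have : m * x = m * y := by simpa using hxy
  exact mul_left_cancel₀ hm this

lemma FF_quot (u1 m r : ℤ) (hm : m ≠ 0) (A B : Finset ℤ) :
    (FF u1 m (B.image (fun x => r + m * x)) A).card = (B.image (fun x => u1 * x) + A).card := by
  have : FF u1 m (B.image (fun x => r + m * x)) A
      = (B.image (fun x => u1 * x) + A).image (fun x => u1 * r + m * x) := by
    ext z
    simp only [FF, Finset.mem_add, Finset.mem_image]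
    constructor
    · rintro ⟨_, ⟨_, ⟨b, hb, rfl⟩, rfl⟩, _, ⟨a, ha, rfl⟩, rfl⟩
      exact ⟨u1 * b + a, ⟨_, ⟨b, hb, rfl⟩, a, ha, rfl⟩, by ring⟩
    · rintro ⟨_, ⟨_, ⟨b, hb, rfl⟩, a, ha, rfl⟩, rfl⟩
      exact ⟨_, ⟨_, ⟨b, hb, rfl⟩, rfl⟩, _, ⟨a, ha, rfl⟩, by ring⟩
  rw [this]
  apply Finset.card_image_of_injective
  intro x y hxy
  have : m * x = m * y := by simpa using hxy
  exact mul_left_cancel₀ hm this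

lemma norm_aux (u1 u2 : ℤ) (h1 : 1 ≤ u1) (h3 : 3 ≤ u2) (hc : IsCoprime u1 u2)
    (A : Finset ℤ) (h0 : (0 : ℤ) ∈ A) (hg : ∀ d : ℤ, (∀ a ∈ A, d ∣ a) → IsUnit d) :
    7 * A.card ≤ 2 * (FF u1 u2 A A).card + 6 := by
  classical
  have hAne : A.Nonempty := ⟨0, h0⟩
  have hu1 : u1 ≠ 0 := by omega
  have hu2 : u2 ≠ 0 := by omega
  have nodiv : ∀ m : ℤ, 2 ≤ m → ∃ a ∈ A, ¬ m ∣ a := by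
    intro m hm
    by_contra! h
    have := Int.isUnit_iff.1 (hg m h)
    omega
  obtain ⟨r, hr, hrn⟩ := nodiv u2 (by omega)
  have hApos := hAne.card_pos
  by_cases h3c : ∃ a ∈ A, ¬ u2 ∣ a ∧ ¬ u2 ∣ a - r
  · obtain ⟨a, ha, hna, hnar⟩ := h3c
    have : 3 ≤ ncl u2 (A.image (fun x => u1 * x)) := by
      have cop : ∀ x, u2 ∣ u1 * x → u2 ∣ x := fun x hx => hc.symm.dvd_of_dvd_mul_left hx
      apply ncl_three u2 _ (u1 * a) (u1 * r) (u1 * 0)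
        (Finset.mem_image_of_mem _ ha) (Finset.mem_image_of_mem _ hr)
        (Finset.mem_image_of_mem _ h0)
      · rw [← mul_sub]; exact fun h => hnar (cop _ h)
      · rw [← mul_sub, sub_zero]; exact fun h => hna (cop _ h)
      · rw [← mul_sub, sub_zero]; exact fun h => hrn (cop _ h)
    have := cls_le u2 3 (A.image (fun x => u1 * x)) (A.image (fun x => u2 * x))
      (hAne.image _) (by
        intro y hy y' hy'
        obtain ⟨a, _, rfl⟩ := Finset.mem_image.1 hy
        obtain ⟨b, _, rfl⟩ := Finset.mem_image.1 hy'
        exact dvd_sub (dvd_mul_right _ _) (dvd_mul_right _ _)) this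
    rw [card_dil _ hu1, card_dil _ hu2] at this
    change _ ≤ (FF u1 u2 A A).card + 3 at this
    omega
  · push Not at h3c
    set A1 := A.filter (fun a => u2 ∣ a) with hA1
    set A2 := A.filter (fun a => ¬ u2 ∣ a) with hA2
    have hU : A1 ∪ A2 = A := Finset.filter_union_filter_not_eq _ _
    have hcard : A1.card + A2.card = A.card := Finset.card_filter_add_card_filter_not _
    have n1 : A1.Nonempty := ⟨0, by simp [hA1, h0]⟩
    have n2 : A2.Nonempty := ⟨r, by simp [hA2, hr, hrn]⟩
    have d1 : ∀ a ∈ A1, u2 ∣ a - 0 := by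
      intro a ha; simpa using (Finset.mem_filter.1 ha).2
    have d2 : ∀ a ∈ A2, u2 ∣ a - r := by
      intro a ha
      exact h3c a (Finset.mem_filter.1 ha).1 (Finset.mem_filter.1 ha).2
    obtain ⟨B1, e1, c1⟩ := exists_quot u2 0 hu2 A1 d1
    obtain ⟨B2, e2, c2⟩ := exists_quot u2 r hu2 A2 d2
    have f1 := FF_quot u1 u2 0 hu2 A B1
    have f2 := FF_quot u1 u2 r hu2 A B2
    rw [← e1] at f1
    rw [← e2] at f2
    have hsum : (FF u1 u2 A1 A).card + (FF u1 u2 A2 A).card ≤ (FF u1 u2 A A).card := by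
      rw [← Finset.card_union_of_disjoint]
      · apply Finset.card_le_card
        apply Finset.union_subset
        · exact Finset.add_subset_add_right (Finset.image_subset_image (Finset.filter_subset _ _))
        · exact Finset.add_subset_add_right (Finset.image_subset_image (Finset.filter_subset _ _))
      · rw [Finset.disjoint_left]
        intro z hz hz'
        simp only [FF, Finset.mem_add, Finset.mem_image] at hz hz'
        obtain ⟨_, ⟨a, ha, rfl⟩, _, ⟨b, hb, rfl⟩, rfl⟩ := hz
        obtain ⟨_, ⟨a', ha', rfl⟩, _, ⟨b', hb', rfl⟩, h⟩ := hz'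
        have k1 := (Finset.mem_filter.1 ha).2
        have k2 := (Finset.mem_filter.1 ha').2
        apply k2
        apply hc.symm.dvd_of_dvd_mul_left
        have : u1 * a' = u1 * a + u2 * (b - b') := by linarith
        rw [this]
        exact dvd_add (Dvd.dvd.mul_left k1 _) (dvd_mul_right _ _)
    rw [f1, f2] at hsum
    have p1 := n1.card_pos
    have p2 := n2.card_pos
    rcases eq_or_lt_of_le h1 with hu | hu
    · subst hu
      simp only [one_mul, Finset.image_id'] at hsum
      have hcop : IsCoprime u2 r := by
        rw [Int.isCoprime_iff_gcd_eq_one]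
        have := hg (Int.gcd u2 r) (by
          intro a ha
          by_cases q : u2 ∣ a
          · exact (Int.gcd_dvd_left _ _).trans q
          · have t1 := (Int.gcd_dvd_left u2 r).trans (h3c a ha q)
            have := dvd_add t1 (Int.gcd_dvd_right u2 r)
            simpa using this)
        have := Int.isUnit_iff.1 this
        omega
      have hr2 : ¬ u2 ∣ 2 * r := by
        intro h
        have := Int.le_of_dvd (by norm_num) (hcop.dvd_of_dvd_mul_right h)
        omega
      rcases le_total A2.card A1.card with hle | hle
      · have := core_aux u2 r hrn hr2 B1 B2 A1 A2 n1 n2 c1 c2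
          (fun y hy y' hy' => by simpa using dvd_sub (d1 y hy) (d1 y' hy'))
          (fun y hy y' hy' => by
            have := dvd_sub (d2 y' hy') (d1 y hy)
            have e : y' - y - r = y' - r - (y - 0) := by ring
            rwa [e]) hle
        rw [hU] at this
        omega
      · have := core_aux u2 (-r) (by simpa using hrn) (by simpa using hr2) B2 B1 A2 A1 n2 n1 c2 c1
          (fun y hy y' hy' => by simpa using dvd_sub (d2 y hy) (d2 y' hy'))
          (fun y hy y' hy' => by
            have := dvd_sub (d1 y' hy') (d2 y hy)
            have e : y' - y - -r = y' - 0 - (y - r) := by ring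
            rwa [e]) hle
        rw [Finset.union_comm, hU] at this
        omega
    · obtain ⟨s, hs, hsn⟩ := nodiv u1 (by omega)
      have hA2 : 2 ≤ ncl u1 A := ncl_two u1 A s 0 hs h0 (by simpa using hsn)
      have go : ∀ B : Finset ℤ, B.Nonempty →
          A.card + 2 * B.card ≤ (B.image (fun x => u1 * x) + A).card + 2 := by
        intro B hB
        have := cls_le u1 2 A (B.image (fun x => u1 * x)) (hB.image _) (by
          intro y hy y' hy'
          obtain ⟨a, _, rfl⟩ := Finset.mem_image.1 hy
          obtain ⟨b, _, rfl⟩ := Finset.mem_image.1 hy'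
          exact dvd_sub (dvd_mul_right _ _) (dvd_mul_right _ _)) hA2
        rwa [card_dil _ hu1, add_comm A] at this
      have g1 := go B1 (Finset.card_pos.1 (by omega))
      have g2 := go B2 (Finset.card_pos.1 (by omega))
      omega

lemma FF_affine (u1 u2 c D : ℤ) (hD : D ≠ 0) (A : Finset ℤ) :
    (FF u1 u2 (A.image (fun x => c + D * x)) (A.image (fun x => c + D * x))).card
      = (FF u1 u2 A A).card := by
  have : FF u1 u2 (A.image (fun x => c + D * x)) (A.image (fun x => c + D * x))
      = (FF u1 u2 A A).image (fun x => (u1 + u2) * c + D * x) := by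
    ext z
    simp only [FF, Finset.mem_add, Finset.mem_image]
    constructor
    · rintro ⟨_, ⟨_, ⟨b, hb, rfl⟩, rfl⟩, _, ⟨_, ⟨a, ha, rfl⟩, rfl⟩, rfl⟩
      exact ⟨u1 * b + u2 * a, ⟨_, ⟨b, hb, rfl⟩, _, ⟨a, ha, rfl⟩, rfl⟩, by ring⟩
    · rintro ⟨_, ⟨_, ⟨b, hb, rfl⟩, _, ⟨a, ha, rfl⟩, rfl⟩, rfl⟩
      exact ⟨_, ⟨_, ⟨b, hb, rfl⟩, rfl⟩, _, ⟨_, ⟨a, ha, rfl⟩, rfl⟩, by ring⟩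
  rw [this]
  apply Finset.card_image_of_injective
  intro x y hxy
  have : D * x = D * y := by simpa using hxy
  exact mul_left_cancel₀ hD this

lemma main_aux (u1 u2 : ℤ) (h1 : 1 ≤ u1) (h3 : 3 ≤ u2) (hc : IsCoprime u1 u2)
    (A : Finset ℤ) (hA : A.Nonempty) :
    7 * A.card ≤ 2 * (FF u1 u2 A A).card + 6 := by
  obtain ⟨a0, ha0⟩ := hA
  by_cases hone : A.card = 1
  · have : (FF u1 u2 A A).Nonempty :=
      Finset.Nonempty.add (Finset.Nonempty.image ⟨a0, ha0⟩ _) (Finset.Nonempty.image ⟨a0, ha0⟩ _)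
    have := this.card_pos
    omega
  have hpos : 0 < A.card := Finset.card_pos.2 ⟨a0, ha0⟩
  obtain ⟨a1, ha1, hne⟩ := Finset.exists_mem_ne (show 1 < A.card by omega) a0
  obtain ⟨g, hg, hg1⟩ := Finset.extract_gcd (fun a => a - a0) ⟨a0, ha0⟩
  set D := A.gcd (fun a => a - a0) with hDdef
  have hD : D ≠ 0 := by
    intro h
    have := hg a1 ha1
    rw [h, zero_mul] at this
    omega
  have hAe : A = (A.image g).image (fun x => a0 + D * x) := by
    rw [Finset.image_image]
    conv_lhs => rw [← Finset.image_id (s := A)]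
    apply Finset.image_congr
    intro a ha
    have := hg a ha
    simp only [id, Function.comp]
    linarith
  have hcard : (A.image g).card = A.card := by
    conv_rhs => rw [hAe]
    symm
    apply Finset.card_image_of_injective
    intro x y hxy
    have : D * x = D * y := by simpa using hxy
    exact mul_left_cancel₀ hD this
  have key := norm_aux u1 u2 h1 h3 hc (A.image g) (by
      rw [Finset.mem_image]
      refine ⟨a0, ha0, ?_⟩
      have := hg a0 ha0
      simp only [sub_self] at this
      rcases mul_eq_zero.1 this.symm with h | h
      · exact absurd h hD
      · exact h) (by
      intro d hd
      have : d ∣ A.gcd g := Finset.dvd_gcd (fun b hb => hd _ (Finset.mem_image_of_mem _ hb))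
      rw [hg1] at this
      exact isUnit_of_dvd_one this)
  rw [hcard, ← FF_affine u1 u2 a0 D hD, ← hAe] at key
  exact key

lemma fimg_eq_s7 (u1 u2 : ℤ) (A : Finset ℤ) : fimg 2 ![u1, u2] A = FF u1 u2 A A := by
  ext z
  simp only [fimg, FF, Finset.mem_add, Finset.mem_image, Fintype.mem_piFinset, Fin.sum_univ_two,
    Matrix.cons_val_zero, Matrix.cons_val_one]
  constructor
  · rintro ⟨x, hx, rfl⟩
    exact ⟨_, ⟨x 0, hx 0, rfl⟩, _, ⟨x 1, hx 1, rfl⟩, rfl⟩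
  · rintro ⟨_, ⟨a, ha, rfl⟩, _, ⟨b, hb, rfl⟩, rfl⟩
    refine ⟨![a, b], ?_, by simp⟩
    intro i
    fin_cases i
    · simpa using ha
    · simpa using hb

theorem stmt7 (u1 u2 : ℤ) (h1 : 1 ≤ u1) (h12 : u1 < u2) (hgcd : Int.gcd u1 u2 = 1)
    (hne1 : ¬(u1 = 1 ∧ u2 = 1)) (hne2 : ¬(u1 = 1 ∧ u2 = 2)) (k : ℕ) (hk : 0 < k) :
    (7 * k - 5) / 2 ≤ Nf 2 ![u1, u2] k := by
  have hne : {n : ℕ | ∃ A : Finset ℤ, A.card = k ∧ (fimg 2 ![u1, u2] A).card = n}.Nonempty := by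
    obtain ⟨A, hA⟩ := Infinite.exists_subset_card_eq ℤ k
    exact ⟨_, A, hA, rfl⟩
  obtain ⟨A, hA, hn⟩ := Nat.sInf_mem hne
  change _ = Nf 2 ![u1, u2] k at hn
  have := main_aux u1 u2 h1 (by omega) (Int.isCoprime_iff_gcd_eq_one.2 hgcd) A
    (Finset.card_pos.1 (by omega))
  rw [← fimg_eq_s7, hn, hA] at this
  omega
end

section
/- Let f(x_1,x_2) = u_1x_1 + u_2x_2 be a binary linear form with positive integer coefficients satisfying 1 ≤ u_1 < u_2, gcd(u_1,u_2) = 1, and u_2 ≥ 3. Then N_f(3) ≥ 8; that is, for every set A of three integers, |f(A)| ≥ 8. -/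
open Finset

lemma card8 (S : Finset ℤ) (a b c d e f g h : ℤ) (ha : a ∈ S) (hb : b ∈ S) (hc : c ∈ S)
    (hd : d ∈ S) (he : e ∈ S) (hf : f ∈ S) (hg : g ∈ S) (hh : h ∈ S)
    (hn : [a, b, c, d, e, f, g, h].Nodup) : 8 ≤ S.card := by
  have h1 : [a, b, c, d, e, f, g, h].toFinset.card = 8 := by
    rw [List.toFinset_card_of_nodup hn]; rfl
  rw [← h1]
  apply Finset.card_le_card
  intro x hx
  simp only [List.mem_toFinset, List.mem_cons, List.not_mem_nil, or_false] at hx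
  rcases hx with rfl | rfl | rfl | rfl | rfl | rfl | rfl | rfl <;> assumption

lemma golden (u v p q : ℤ) (hu : 1 ≤ u) (hv : 3 ≤ v) (hc : IsCoprime u v) (hp : 0 < p)
    (e1 : v * p = u * q) (e3 : v * q = u * p + u * q) : False := by
  have h : p * (v * v) = p * (u * u + u * v) := by
    linear_combination (v - u) * e1 + u * e3
  have h2 := mul_left_cancel₀ hp.ne' h
  have h4 : v ∣ u * u := ⟨v - u, by linear_combination -h2⟩
  have h5 : IsCoprime (u * u) v := hc.mul_left hc
  have h6 : IsUnit v := h5.isUnit_of_dvd' h4 dvd_rfl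
  rcases Int.isUnit_iff.mp h6 with h | h <;> omega

lemma mem_fimg2 (u v : ℤ) (A : Finset ℤ) (x y : ℤ) (hx : x ∈ A) (hy : y ∈ A) :
    u * x + v * y ∈ fimg 2 ![u, v] A := by
  unfold fimg
  refine Finset.mem_image.mpr ⟨![x, y], ?_, by simp [Fin.sum_univ_two]⟩
  rw [Fintype.mem_piFinset]
  intro i
  fin_cases i <;> simpa

lemma sorted3 (A : Finset ℤ) (h : A.card = 3) :
    ∃ a p q : ℤ, 0 < p ∧ 0 < q ∧ a ∈ A ∧ a + p ∈ A ∧ a + p + q ∈ A := by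
  let e := A.orderEmbOfFin h
  have h01 : e 0 < e 1 := e.strictMono (by decide)
  have h12 : e 1 < e 2 := e.strictMono (by decide)
  refine ⟨e 0, e 1 - e 0, e 2 - e 1, by omega, by omega, A.orderEmbOfFin_mem h 0, ?_, ?_⟩
  · have := A.orderEmbOfFin_mem h 1
    simpa [e] using this
  · have := A.orderEmbOfFin_mem h 2
    simpa [e] using this

lemma main8 (S : Finset ℤ) (w P Q R T : ℤ) (hP : 0 < P) (hQ : 0 < Q) (hR : P < R) (hT : Q < T)
    (h13 : ¬(R = Q ∧ T = P + Q)) (h24 : ¬(R = P + Q ∧ T = P))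
    (h23 : ¬(R = P + Q ∧ T = P + Q))
    (m00 : w ∈ S) (m10 : w + P ∈ S) (m20 : w + P + Q ∈ S)
    (m01 : w + R ∈ S) (m11 : w + P + R ∈ S) (m21 : w + P + Q + R ∈ S)
    (m02 : w + R + T ∈ S) (m12 : w + P + R + T ∈ S) (m22 : w + P + Q + R + T ∈ S) :
    8 ≤ S.card := by
  by_cases e1 : R = Q
  · apply card8 S _ _ _ _ _ _ _ _ m00 m10 m20 m01 m21 m02 m12 m22
    simp only [List.nodup_cons, List.mem_cons, List.not_mem_nil, List.nodup_nil, not_false_eq_true, or_false, and_true]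
    omega
  by_cases e2 : R = P + Q
  · apply card8 S _ _ _ _ _ _ _ _ m00 m10 m20 m11 m21 m02 m12 m22
    simp only [List.nodup_cons, List.mem_cons, List.not_mem_nil, List.nodup_nil, not_false_eq_true, or_false, and_true]
    omega
  · apply card8 S _ _ _ _ _ _ _ _ m00 m10 m20 m01 m11 m21 m12 m22
    simp only [List.nodup_cons, List.mem_cons, List.not_mem_nil, List.nodup_nil, not_false_eq_true, or_false, and_true]
    omega

theorem stmt8 (u1 u2 : ℤ) (h1 : 1 ≤ u1) (h12 : u1 < u2) (hgcd : Int.gcd u1 u2 = 1)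
    (h3 : 3 ≤ u2) :
    8 ≤ Nf 2 ![u1, u2] 3 ∧
    ∀ A : Finset ℤ, A.card = 3 → 8 ≤ (fimg 2 ![u1, u2] A).card := by
  have key : ∀ A : Finset ℤ, A.card = 3 → 8 ≤ (fimg 2 ![u1, u2] A).card := by
    intro A hA
    obtain ⟨a, p, q, hp, hq, ma, mb, mc⟩ := sorted3 A hA
    have hc : IsCoprime u1 u2 := Int.isCoprime_iff_gcd_eq_one.mpr hgcd
    have M := mem_fimg2 u1 u2 A
    apply main8 _ (u1 * a + u2 * a) (u1 * p) (u1 * q) (u2 * p) (u2 * q)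
      (by positivity) (by positivity) (by nlinarith) (by nlinarith)
    · rintro ⟨e1, e3⟩
      exact golden u1 u2 p q h1 h3 hc hp e1 e3
    · rintro ⟨e2, e4⟩
      exact golden u1 u2 q p h1 h3 hc hq e4 (by linarith)
    · rintro ⟨e2, e3⟩
      have hpq : p = q := mul_left_cancel₀ (show u2 ≠ 0 by omega) (e2.trans e3.symm)
      subst hpq
      have hv : u2 = 2 * u1 := mul_right_cancel₀ hp.ne' (by linarith)
      have h6 : IsUnit u1 := hc.isUnit_of_dvd' dvd_rfl ⟨2, by linarith⟩
      rcases Int.isUnit_iff.mp h6 with h | h <;> omega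
    · exact M a a ma ma
    · convert M _ _ mb ma using 1; ring
    · convert M _ _ mc ma using 1; ring
    · convert M _ _ ma mb using 1; ring
    · convert M _ _ mb mb using 1; ring
    · convert M _ _ mc mb using 1; ring
    · convert M _ _ ma mc using 1; ring
    · convert M _ _ mb mc using 1; ring
    · convert M _ _ mc mc using 1; ring
  refine ⟨?_, key⟩
  unfold Nf
  apply le_csInf
  · exact ⟨_, {0, 1, 2}, by decide, rfl⟩
  · rintro n ⟨A, hA, rfl⟩
    exact key A hA
end

section
/- Let f(x_1,x_2,x_3) = u_1x_1 + u_2x_2 + u_3x_3 be a ternary linear form with positive integer coefficients satisfying 1 ≤ u_1 < u_2 < u_3. Then N_f(2) = 7 or N_f(2) = 8, and N_f(2) = 8 if and only if u_1 + u_2 ≠ u_3 (equivalently, N_f(2) = 7 if and only if u_1 + u_2 = u_3). -/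
open Finset

/-- The eight subset sums of the coefficients. -/
def subsetSums (u1 u2 u3 : ℤ) : Finset ℤ :=
  {0, u1, u2, u3, u1 + u2, u1 + u3, u2 + u3, u1 + u2 + u3}

lemma fimg_pair (u1 u2 u3 a b : ℤ) :
    fimg 3 ![u1, u2, u3] {a, b} =
      (subsetSums u1 u2 u3).image (fun t => (u1 + u2 + u3) * a + (b - a) * t) := by
  ext y
  simp only [fimg, subsetSums, Finset.mem_image, Fintype.mem_piFinset, Finset.mem_insert,
    Finset.mem_singleton, Fin.sum_univ_three]
  constructor
  · rintro ⟨x, hx, rfl⟩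
    refine ⟨(if x 0 = a then 0 else u1) + (if x 1 = a then 0 else u2)
      + (if x 2 = a then 0 else u3), ?_, ?_⟩
    · split_ifs <;> simp
    · simp only [Matrix.cons_val_zero, Matrix.cons_val_one, Matrix.cons_val]
      have e0 := hx 0
      have e1 := hx 1
      have e2 := hx 2
      split_ifs with p q r r q r r <;> simp_all <;> ring
  · have key : ∀ p q r : ℤ, (p = a ∨ p = b) → (q = a ∨ q = b) → (r = a ∨ r = b) →
        u1 * p + u2 * q + u3 * r = y →
        ∃ x : Fin 3 → ℤ, (∀ i, x i = a ∨ x i = b) ∧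
          ![u1, u2, u3] 0 * x 0 + ![u1, u2, u3] 1 * x 1 + ![u1, u2, u3] 2 * x 2 = y := by
      intro p q r hp hq hr h
      refine ⟨![p, q, r], ?_, by simpa using h⟩
      intro i
      fin_cases i <;> simpa
    rintro ⟨t, ht, hy⟩
    rcases ht with rfl | rfl | rfl | rfl | rfl | rfl | rfl | rfl
    · exact key a a a (by simp) (by simp) (by simp) (by rw [← hy]; ring)
    · exact key b a a (by simp) (by simp) (by simp) (by rw [← hy]; ring)
    · exact key a b a (by simp) (by simp) (by simp) (by rw [← hy]; ring)
    · exact key a a b (by simp) (by simp) (by simp) (by rw [← hy]; ring)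
    · exact key b b a (by simp) (by simp) (by simp) (by rw [← hy]; ring)
    · exact key b a b (by simp) (by simp) (by simp) (by rw [← hy]; ring)
    · exact key a b b (by simp) (by simp) (by simp) (by rw [← hy]; ring)
    · exact key b b b (by simp) (by simp) (by simp) (by rw [← hy]; ring)

lemma card_fimg_pair (u1 u2 u3 a b : ℤ) (h : a ≠ b) :
    (fimg 3 ![u1, u2, u3] {a, b}).card = (subsetSums u1 u2 u3).card := by
  rw [fimg_pair]
  apply Finset.card_image_of_injective
  intro s t hst
  have hba : b - a ≠ 0 := sub_ne_zero.mpr h.symm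
  exact mul_left_cancel₀ hba (add_left_cancel hst)

lemma Nf_two (u1 u2 u3 : ℤ) : Nf 3 ![u1, u2, u3] 2 = (subsetSums u1 u2 u3).card := by
  have : {n : ℕ | ∃ A : Finset ℤ, A.card = 2 ∧ (fimg 3 ![u1, u2, u3] A).card = n}
      = {(subsetSums u1 u2 u3).card} := by
    ext n
    simp only [Set.mem_setOf_eq, Set.mem_singleton_iff]
    constructor
    · rintro ⟨A, hA, rfl⟩
      obtain ⟨a, b, hab, rfl⟩ := Finset.card_eq_two.mp hA
      exact card_fimg_pair u1 u2 u3 a b hab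
    · rintro rfl
      exact ⟨{0, 1}, by simp, card_fimg_pair u1 u2 u3 0 1 (by simp)⟩
  rw [Nf, this, csInf_singleton]

lemma card_eight (u1 u2 u3 : ℤ) (h1 : 1 ≤ u1) (h12 : u1 < u2) (h23 : u2 < u3)
    (h : u1 + u2 ≠ u3) : (subsetSums u1 u2 u3).card = 8 := by
  unfold subsetSums
  repeat rw [Finset.card_insert_of_notMem
    (by simp only [Finset.mem_insert, Finset.mem_singleton]; omega)]
  simp

lemma card_seven (u1 u2 u3 : ℤ) (h1 : 1 ≤ u1) (h12 : u1 < u2) (h23 : u2 < u3)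
    (h : u1 + u2 = u3) : (subsetSums u1 u2 u3).card = 7 := by
  have e : subsetSums u1 u2 u3 = {0, u1, u2, u1 + u2, u1 + u3, u2 + u3, u1 + u2 + u3} := by
    unfold subsetSums
    rw [← h]
    simp
  rw [e]
  repeat rw [Finset.card_insert_of_notMem
    (by simp only [Finset.mem_insert, Finset.mem_singleton]; omega)]
  simp

theorem stmt10 (u1 u2 u3 : ℤ) (h1 : 1 ≤ u1) (h12 : u1 < u2) (h23 : u2 < u3) :
    (Nf 3 ![u1, u2, u3] 2 = 7 ∨ Nf 3 ![u1, u2, u3] 2 = 8) ∧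
    (Nf 3 ![u1, u2, u3] 2 = 8 ↔ u1 + u2 ≠ u3) ∧
    (Nf 3 ![u1, u2, u3] 2 = 7 ↔ u1 + u2 = u3) := by
  rw [Nf_two]
  by_cases h : u1 + u2 = u3
  · have := card_seven u1 u2 u3 h1 h12 h23 h
    simp [this, h]
  · have := card_eight u1 u2 u3 h1 h12 h23 h
    simp [this, h]
end

section
/- Let f(x_1,x_2,x_3) = u_1x_1 + u_2x_2 + u_3x_3 be a ternary linear form with positive integer coefficients satisfying 1 ≤ u_1 < u_2 < u_3 and gcd(u_1,u_2,u_3) = 1. Then N_f(k) ≥ 6k − 5 for every positive integer k. If moreover u_1 + u_2 ≠ u_3, then N_f(k) ≥ 7k − 6 for every positive integer k. -/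
open Finset

theorem mem_fimg3 (u1 u2 u3 : ℤ) (A : Finset ℤ) (y : ℤ) :
    y ∈ fimg 3 ![u1, u2, u3] A ↔
      ∃ a ∈ A, ∃ b ∈ A, ∃ c ∈ A, u1 * a + u2 * b + u3 * c = y := by
  unfold fimg
  simp only [Finset.mem_image, Fintype.mem_piFinset, Fin.sum_univ_three]
  constructor
  · rintro ⟨x, hx, rfl⟩
    exact ⟨x 0, hx 0, x 1, hx 1, x 2, hx 2, by simp⟩
  · rintro ⟨a, ha, b, hb, c, hc, rfl⟩
    refine ⟨![a, b, c], ?_, by simp⟩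
    intro i
    fin_cases i <;> simpa

/-- Each step from one element of `A` to the next contributes at least `T.card` new values,
where `T` is any set of positive subset sums of the coefficients. -/
theorem fimg3_card (u1 u2 u3 : ℤ) (h1 : 0 < u1) (h2 : 0 < u2) (h3 : 0 < u3) (T : Finset ℤ)
    (hpos : ∀ t ∈ T, 0 < t)
    (hT : ∀ t ∈ T, ∃ e1 e2 e3 : Bool,
      (if e1 then u1 else 0) + (if e2 then u2 else 0) + (if e3 then u3 else 0) = t)
    (A : Finset ℤ) : A.Nonempty →
      T.card * A.card + 1 ≤ (fimg 3 ![u1, u2, u3] A).card + T.card := by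
  induction A using Finset.induction_on_max with
  | empty => simp
  | insert b s hb ih =>
    intro _
    have hbs : b ∉ s := fun h => lt_irrefl _ (hb b h)
    rcases s.eq_empty_or_nonempty with rfl | hs
    · have : (fimg 3 ![u1, u2, u3] (insert b ∅)).Nonempty :=
        ⟨_, (mem_fimg3 _ _ _ _ _).2 ⟨b, by simp, b, by simp, b, by simp, rfl⟩⟩
      have := this.card_pos
      simp only [Finset.card_insert_of_notMem hbs, Finset.card_empty]
      omega
    · have ih := ih hs
      obtain ⟨a, ha, hmax⟩ : ∃ a ∈ s, ∀ x ∈ s, x ≤ a :=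
        ⟨s.max' hs, s.max'_mem hs, fun x hx => s.le_max' x hx⟩
      have hab : 0 < b - a := sub_pos.2 (hb a ha)
      set g : ℤ → ℤ := fun t => (u1 + u2 + u3) * a + t * (b - a) with hg
      have hinj : Function.Injective g := by
        intro x y hxy
        have : x * (b - a) = y * (b - a) := by simpa [hg] using hxy
        exact mul_right_cancel₀ hab.ne' this
      have hdisj : Disjoint (fimg 3 ![u1, u2, u3] s) (T.image g) := by
        rw [Finset.disjoint_left]
        intro y hy hy'
        obtain ⟨p, hp, q, hq, r, hr, rfl⟩ := (mem_fimg3 _ _ _ _ _).1 hy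
        obtain ⟨t, ht, h⟩ := Finset.mem_image.1 hy'
        have := mul_pos (hpos t ht) hab
        have e1 := mul_le_mul_of_nonneg_left (hmax p hp) h1.le
        have e2 := mul_le_mul_of_nonneg_left (hmax q hq) h2.le
        have e3 := mul_le_mul_of_nonneg_left (hmax r hr) h3.le
        simp only [hg] at h
        linarith
      have hsub : fimg 3 ![u1, u2, u3] s ∪ T.image g ⊆ fimg 3 ![u1, u2, u3] (insert b s) := by
        intro y hy
        rw [mem_fimg3]
        rcases Finset.mem_union.1 hy with hy | hy
        · obtain ⟨p, hp, q, hq, r, hr, h⟩ := (mem_fimg3 _ _ _ _ _).1 hy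
          exact ⟨p, Finset.mem_insert_of_mem hp, q, Finset.mem_insert_of_mem hq, r,
            Finset.mem_insert_of_mem hr, h⟩
        · obtain ⟨t, ht, rfl⟩ := Finset.mem_image.1 hy
          obtain ⟨e1, e2, e3, rfl⟩ := hT t ht
          have hm : ∀ e : Bool, (if e then b else a) ∈ insert b s := by
            intro e
            cases e <;> simp [ha]
          refine ⟨_, hm e1, _, hm e2, _, hm e3, ?_⟩
          cases e1 <;> cases e2 <;> cases e3 <;> simp [hg] <;> ring
      have hc := Finset.card_le_card hsub
      rw [Finset.card_union_of_disjoint hdisj, Finset.card_image_of_injective _ hinj] at hc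
      rw [Finset.card_insert_of_notMem hbs, mul_add]
      omega

theorem le_Nf3 (u1 u2 u3 : ℤ) (h1 : 0 < u1) (h2 : 0 < u2) (h3 : 0 < u3) (T : Finset ℤ)
    (hpos : ∀ t ∈ T, 0 < t)
    (hT : ∀ t ∈ T, ∃ e1 e2 e3 : Bool,
      (if e1 then u1 else 0) + (if e2 then u2 else 0) + (if e3 then u3 else 0) = t)
    (k : ℕ) (hk : 0 < k) :
    T.card * k + 1 ≤ Nf 3 ![u1, u2, u3] k + T.card := by
  have hne : {n : ℕ | ∃ A : Finset ℤ, A.card = k ∧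
      (fimg 3 ![u1, u2, u3] A).card = n}.Nonempty := by
    obtain ⟨A, hA⟩ := Infinite.exists_subset_card_eq ℤ k
    exact ⟨_, A, hA, rfl⟩
  obtain ⟨A, hA, hn⟩ := Nat.sInf_mem hne
  have := fimg3_card u1 u2 u3 h1 h2 h3 T hpos hT A (Finset.card_pos.1 (hA ▸ hk))
  rw [hA, hn] at this
  exact this

theorem stmt12 (u1 u2 u3 : ℤ) (h1 : 1 ≤ u1) (h12 : u1 < u2) (h23 : u2 < u3)
    (hgcd : Int.gcd u1 (Int.gcd u2 u3) = 1) (k : ℕ) (hk : 0 < k) :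
    6 * k - 5 ≤ Nf 3 ![u1, u2, u3] k ∧
    (u1 + u2 ≠ u3 → 7 * k - 6 ≤ Nf 3 ![u1, u2, u3] k) := by
  constructor
  · have h := le_Nf3 u1 u2 u3 (by omega) (by omega) (by omega)
      {u1, u2, u3, u1 + u3, u2 + u3, u1 + u2 + u3}
      (by
        intro t ht
        simp only [Finset.mem_insert, Finset.mem_singleton] at ht
        omega)
      (by
        intro t ht
        simp only [Finset.mem_insert, Finset.mem_singleton] at ht
        rcases ht with rfl | rfl | rfl | rfl | rfl | rfl
        · exact ⟨true, false, false, by simp⟩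
        · exact ⟨false, true, false, by simp⟩
        · exact ⟨false, false, true, by simp⟩
        · exact ⟨true, false, true, by simp⟩
        · exact ⟨false, true, true, by simp⟩
        · exact ⟨true, true, true, by simp⟩) k hk
    have hc : ({u1, u2, u3, u1 + u3, u2 + u3, u1 + u2 + u3} : Finset ℤ).card = 6 := by
      repeat rw [Finset.card_insert_of_notMem
        (by simp only [Finset.mem_insert, Finset.mem_singleton]; omega)]
      simp
    rw [hc] at h
    omega
  · intro hne
    have h := le_Nf3 u1 u2 u3 (by omega) (by omega) (by omega)
      {u1, u2, u3, u1 + u2, u1 + u3, u2 + u3, u1 + u2 + u3}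
      (by
        intro t ht
        simp only [Finset.mem_insert, Finset.mem_singleton] at ht
        omega)
      (by
        intro t ht
        simp only [Finset.mem_insert, Finset.mem_singleton] at ht
        rcases ht with rfl | rfl | rfl | rfl | rfl | rfl | rfl
        · exact ⟨true, false, false, by simp⟩
        · exact ⟨false, true, false, by simp⟩
        · exact ⟨false, false, true, by simp⟩
        · exact ⟨true, true, false, by simp⟩
        · exact ⟨true, false, true, by simp⟩
        · exact ⟨false, true, true, by simp⟩
        · exact ⟨true, true, true, by simp⟩) k hk
    have hc : ({u1, u2, u3, u1 + u2, u1 + u3, u2 + u3, u1 + u2 + u3} : Finset ℤ).card = 7 := by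
      repeat rw [Finset.card_insert_of_notMem
        (by simp only [Finset.mem_insert, Finset.mem_singleton]; omega)]
      simp
    rw [hc] at h
    omega
end

section
/- Let (u_1,...,u_m) be a complete sequence of positive integers with U = u_1 + ⋯ + u_m, and let f(x_1,...,x_m) = u_1x_1 + ⋯ + u_mx_m. Then for all integers a < b, f({a,b}) = {Ua + ℓ(b − a) : ℓ = 0,1,...,U}, and consequently f({0,1,...,k−1}) = {0,1,...,U(k−1)} for every positive integer k. -/
open Finset

/-- A finite sequence `(u_1,…,u_m)` of positive integers is complete if its set of subset
sums is exactly the interval of integers `[0, U]`, where `U = u_1 + ⋯ + u_m`. -/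
def IsCompleteSeq (m : ℕ) (u : Fin m → ℤ) : Prop :=
  (Finset.univ.powerset.image fun J : Finset (Fin m) => ∑ j ∈ J, u j)
    = Finset.Icc 0 (∑ j, u j)

theorem stmt15 (m : ℕ) (hm : 0 < m) (u : Fin m → ℤ) (hu : ∀ j, 0 < u j)
    (hcomp : IsCompleteSeq m u) :
    (∀ a b : ℤ, a < b →
      fimg m u {a, b} =
        (Finset.Icc (0 : ℤ) (∑ j, u j)).image fun l => (∑ j, u j) * a + l * (b - a)) ∧
    ∀ k : ℕ, 0 < k →
      fimg m u ((Finset.range k).image fun i : ℕ => (i : ℤ))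
        = Finset.Icc 0 ((∑ j, u j) * ((k : ℤ) - 1)) := by
  have key : ∀ l, 0 ≤ l → l ≤ ∑ j, u j → ∃ J : Finset (Fin m), ∑ j ∈ J, u j = l := by
    intro l h0 h1
    have h : l ∈ Finset.Icc 0 (∑ j, u j) := Finset.mem_Icc.2 ⟨h0, h1⟩
    rw [← hcomp] at h
    obtain ⟨J, -, hJ⟩ := Finset.mem_image.1 h
    exact ⟨J, hJ⟩
  have form : ∀ (J : Finset (Fin m)) (a b : ℤ),
      ∑ j, u j * (if j ∈ J then b else a) = (∑ j, u j) * a + (∑ j ∈ J, u j) * (b - a) := by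
    intro J a b
    have h : ∑ j ∈ J, u j = ∑ j, if j ∈ J then u j else 0 := by simp
    rw [h, Finset.sum_mul, Finset.sum_mul, ← Finset.sum_add_distrib]
    refine Finset.sum_congr rfl fun j _ => ?_
    split_ifs <;> ring
  have hU : 0 < ∑ j, u j :=
    Finset.sum_pos (fun j _ => hu j) ⟨⟨0, hm⟩, Finset.mem_univ _⟩
  refine ⟨?_, ?_⟩
  · intro a b hab
    ext n
    simp only [fimg, Finset.mem_image, Fintype.mem_piFinset, Finset.mem_insert,
      Finset.mem_singleton, Finset.mem_Icc]
    constructor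
    · rintro ⟨x, hx, rfl⟩
      let J : Finset (Fin m) := Finset.univ.filter fun j => x j = b
      refine ⟨∑ j ∈ J, u j, ⟨Finset.sum_nonneg fun j _ => (hu j).le,
        Finset.sum_le_sum_of_subset_of_nonneg (Finset.subset_univ _)
          fun j _ _ => (hu j).le⟩, ?_⟩
      rw [← form]
      refine Finset.sum_congr rfl fun j _ => ?_
      by_cases h : x j = b
      · simp [J, h]
      · simp [J, h, (hx j).resolve_right h, hab.ne]
    · rintro ⟨l, ⟨h0, h1⟩, rfl⟩
      obtain ⟨J, rfl⟩ := key l h0 h1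
      refine ⟨fun j => if j ∈ J then b else a, fun j => ?_, form J a b⟩
      by_cases h : j ∈ J <;> simp [h]
  · intro k hk
    have hmem : ∀ z : ℤ, (∃ i ∈ Finset.range k, (i : ℤ) = z) ↔ 0 ≤ z ∧ z ≤ (k : ℤ) - 1 := by
      intro z
      constructor
      · rintro ⟨i, hi, rfl⟩
        have := Finset.mem_range.1 hi
        omega
      · rintro ⟨h0, h1⟩
        exact ⟨z.toNat, Finset.mem_range.2 (by omega), by omega⟩
    ext n
    simp only [fimg, Finset.mem_image, Fintype.mem_piFinset, Finset.mem_Icc, hmem]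
    constructor
    · rintro ⟨x, hx, rfl⟩
      refine ⟨Finset.sum_nonneg fun j _ => mul_nonneg (hu j).le (hx j).1, ?_⟩
      rw [Finset.sum_mul]
      exact Finset.sum_le_sum fun j _ => mul_le_mul_of_nonneg_left (hx j).2 (hu j).le
    · rintro ⟨h0, h1⟩
      rcases h1.eq_or_lt with h | h
      · refine ⟨fun _ => (k : ℤ) - 1, fun j => ⟨by dsimp only; omega, le_rfl⟩, ?_⟩
        rw [h, Finset.sum_mul]
      · obtain ⟨J, hJ⟩ := key (n % ∑ j, u j) (Int.emod_nonneg _ hU.ne')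
          (Int.emod_lt_of_pos _ hU).le
        have hq0 : 0 ≤ n / ∑ j, u j := Int.ediv_nonneg h0 hU.le
        have hq1 : n / ∑ j, u j < (k : ℤ) - 1 :=
          Int.ediv_lt_of_lt_mul hU (by rwa [mul_comm])
        refine ⟨fun j => if j ∈ J then n / (∑ j, u j) + 1 else n / ∑ j, u j,
          fun j => ?_, ?_⟩
        · dsimp only
          split_ifs <;> omega
        · rw [form, hJ, add_sub_cancel_left, mul_one]
          exact Int.mul_ediv_add_emod _ _
end

section
/- Let f(x_1,...,x_m) = u_1x_1 + ⋯ + u_mx_m be an m-ary linear form with positive integer coefficients that are pairwise distinct (1 ≤ u_1 < u_2 < ⋯ < u_m). Then for every positive integer k, M_f(k) ≥ k(k−1)⋯(k−m+1). -/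
open Finset

lemma digits_inj_aux (B : ℤ) (hB : 0 < B) : ∀ (k : ℕ) (c d : Fin k → ℤ),
    (∀ i, 0 ≤ c i ∧ c i < B) → (∀ i, 0 ≤ d i ∧ d i < B) →
    ∑ i, c i * B ^ (i : ℕ) = ∑ i, d i * B ^ (i : ℕ) → c = d := by
  intro k
  induction k with
  | zero => intro c d _ _ _; exact Subsingleton.elim _ _
  | succ k ih =>
    intro c d hc hd h
    have key : ∀ e : Fin (k + 1) → ℤ, ∑ i, e i * B ^ (i : ℕ)
        = e 0 + B * ∑ i : Fin k, e i.succ * B ^ (i : ℕ) := by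
      intro e
      rw [Fin.sum_univ_succ, Finset.mul_sum]
      simp only [Fin.val_zero, pow_zero, mul_one, Fin.val_succ]
      congr 1
      exact Finset.sum_congr rfl fun i _ => by ring
    rw [key, key] at h
    have h0 : c 0 = d 0 := by
      have := congrArg (· % B) h
      simpa [Int.add_mul_emod_self_left, Int.emod_eq_of_lt (hc 0).1 (hc 0).2,
        Int.emod_eq_of_lt (hd 0).1 (hd 0).2] using this
    rw [h0] at h
    have h1 := mul_left_cancel₀ hB.ne' (add_left_cancel h)
    have h2 := ih (fun i => c i.succ) (fun i => d i.succ) (fun i => hc _) (fun i => hd _) h1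
    funext i
    refine Fin.cases h0 (fun j => congrFun h2 j) i

theorem stmt17 (m : ℕ) (hm : 0 < m) (u : Fin m → ℤ) (hu : ∀ j, 0 < u j)
    (hmono : StrictMono u) (k : ℕ) (hk : 0 < k) :
    Nat.descFactorial k m ≤ Mf m u k := by
  have hbdd : BddAbove {n : ℕ | ∃ A : Finset ℤ, A.card = k ∧ (fimg m u A).card = n} := by
    refine ⟨k ^ m, ?_⟩
    rintro n ⟨A, hA, rfl⟩
    refine Finset.card_image_le.trans ?_
    simp [Fintype.card_piFinset, hA]
  have hS : 0 ≤ ∑ j, u j := Finset.sum_nonneg fun j _ => (hu j).le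
  obtain ⟨B, hBdef⟩ : ∃ B : ℤ, B = ∑ j, u j + 2 := ⟨_, rfl⟩
  have hB : 1 < B := by omega
  have hpow : Function.Injective fun i : Fin k => B ^ (i : ℕ) := by
    intro a b h
    exact Fin.ext ((pow_right_injective₀ (by omega) (by omega)) h)
  let A : Finset ℤ := Finset.univ.image fun i : Fin k => B ^ (i : ℕ)
  have hA : A.card = k := by
    simp only [A]
    rw [Finset.card_image_of_injective _ hpow]; simp
  refine le_trans ?_ (le_csSup hbdd ⟨A, hA, rfl⟩)
  let c : (Fin m ↪ Fin k) → Fin k → ℤ := fun σ i => ∑ j, if σ j = i then u j else 0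
  let g : (Fin m ↪ Fin k) → ℤ := fun σ => ∑ j, u j * B ^ (σ j : ℕ)
  have hc : ∀ σ i, 0 ≤ c σ i ∧ c σ i < B := by
    intro σ i
    constructor
    · refine Finset.sum_nonneg fun j _ => ?_
      split_ifs
      · exact (hu j).le
      · exact le_rfl
    · have : c σ i ≤ ∑ j, u j := by
        refine Finset.sum_le_sum fun j _ => ?_
        split_ifs
        · exact le_rfl
        · exact (hu j).le
      omega
  have hg : ∀ σ, g σ = ∑ i, c σ i * B ^ (i : ℕ) := by
    intro σ
    simp only [g, c, Finset.sum_mul]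
    rw [Finset.sum_comm]
    refine Finset.sum_congr rfl fun j _ => ?_
    simp [ite_mul]
  have hcσ : ∀ (σ : Fin m ↪ Fin k) j, c σ (σ j) = u j := by
    intro σ j
    simp [c]
  have hginj : Function.Injective g := by
    intro σ τ h
    rw [hg, hg] at h
    have hcc := digits_inj_aux B (by omega) k _ _ (hc σ) (hc τ) h
    ext1 j
    have h1 : c τ (σ j) = u j := by rw [← hcc, hcσ]
    by_cases hex : ∃ l, τ l = σ j
    · obtain ⟨l, hl⟩ := hex
      rw [← hl, hcσ] at h1
      rw [← hl, hmono.injective h1]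
    · push Not at hex
      have h0 : c τ (σ j) = 0 := Finset.sum_eq_zero fun l _ => if_neg (hex l)
      have := hu j
      omega
  have hcard : (Finset.univ.image g).card = Nat.descFactorial k m := by
    rw [Finset.card_image_of_injective _ hginj, Finset.card_univ, Fintype.card_embedding_eq]
    simp
  rw [← hcard]
  refine Finset.card_le_card ?_
  intro x hx
  obtain ⟨σ, -, rfl⟩ := Finset.mem_image.1 hx
  refine Finset.mem_image.2 ⟨fun j => B ^ (σ j : ℕ), ?_, rfl⟩
  rw [Fintype.mem_piFinset]
  intro j
  exact Finset.mem_image_of_mem (fun i : Fin k => B ^ (i : ℕ)) (Finset.mem_univ (σ j))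
end

section
/- Let (u_1,...,u_m) be an increasing sequence of positive integers with distinct subset sums, and let f(x_1,...,x_m) = u_1x_1 + ⋯ + u_mx_m. Then M_f(k) = k^m for every positive integer k; in fact, for g > m·u_m the set A = {1, g, g², ..., g^{k−1}} satisfies |f(A)| = k^m. -/
open Finset

theorem digits_unique (g : ℤ) (k : ℕ) : ∀ (c d : ℕ → ℤ),
    (∀ i, 0 ≤ c i ∧ c i < g) → (∀ i, 0 ≤ d i ∧ d i < g) →
    ∑ i ∈ range k, c i * g ^ i = ∑ i ∈ range k, d i * g ^ i → ∀ i < k, c i = d i := by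
  induction k with
  | zero => intro c d _ _ _ i hi; omega
  | succ k ih =>
    intro c d hc hd h
    have e : ∀ c : ℕ → ℤ, ∑ i ∈ range (k+1), c i * g ^ i
        = (∑ i ∈ range k, c (i+1) * g ^ i) * g + c 0 := by
      intro c
      rw [sum_range_succ', sum_mul]
      simp [pow_succ, mul_assoc]
    rw [e, e] at h
    have hg : 0 < g := lt_of_le_of_lt (hc 0).1 (hc 0).2
    have h0 : c 0 = d 0 := by
      have := congrArg (· % g) h
      simpa [Int.emod_eq_of_lt (hc 0).1 (hc 0).2, Int.emod_eq_of_lt (hd 0).1 (hd 0).2] using this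
    rw [h0] at h
    have h1 := mul_right_cancel₀ hg.ne' (add_right_cancel h)
    intro i hi
    cases i with
    | zero => exact h0
    | succ i =>
      exact ih (fun i => c (i+1)) (fun i => d (i+1)) (fun i => hc _) (fun i => hd _) h1 i (by omega)

theorem fimg_pow_card (m : ℕ) (u : Fin m → ℤ) (hu : ∀ j, 0 < u j)
    (hdss : ∀ I J : Finset (Fin m), ∑ i ∈ I, u i = ∑ j ∈ J, u j → I = J)
    (k : ℕ) (g : ℤ) (hg2 : 1 < g) (hg : ∑ j, u j < g) :
    ((range k).image fun i : ℕ => g ^ i).card = k ∧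
    (fimg m u ((range k).image fun i : ℕ => g ^ i)).card = k ^ m := by
  have hinj : Function.Injective (fun i : ℕ => g ^ i) := by
    intro a b h
    exact (pow_right_strictMono₀ hg2).injective h
  have hA : ((range k).image fun i : ℕ => g ^ i).card = k := by
    rw [card_image_of_injective _ hinj, card_range]
  refine ⟨hA, ?_⟩
  unfold fimg
  rw [card_image_of_injOn, Fintype.card_piFinset_const, hA]
  intro x hx y hy hxy
  have hx' : ∀ j, ∃ i, i < k ∧ g ^ i = x j := by simpa using hx
  have hy' : ∀ j, ∃ i, i < k ∧ g ^ i = y j := by simpa using hy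
  choose a ha hax using hx'
  choose b hb hby using hy'
  have key : ∀ (a : Fin m → ℕ), (∀ j, a j < k) → ∑ j, u j * g ^ a j
      = ∑ i ∈ range k, (∑ j with a j = i, u j) * g ^ i := by
    intro a ha
    rw [← sum_fiberwise_of_maps_to (s := univ) (t := range k) (g := a) (by simpa using ha)]
    refine sum_congr rfl fun i _ => ?_
    rw [sum_mul]
    refine sum_congr rfl fun j hj => ?_
    rw [(mem_filter.1 hj).2]
  have bd : ∀ (a : Fin m → ℕ) (i : ℕ), 0 ≤ (∑ j with a j = i, u j) ∧ (∑ j with a j = i, u j) < g := by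
    intro a i
    refine ⟨sum_nonneg fun j _ => (hu j).le, lt_of_le_of_lt ?_ hg⟩
    exact sum_le_sum_of_subset_of_nonneg (filter_subset _ _) fun j _ _ => (hu j).le
  have hs : ∑ j, u j * g ^ a j = ∑ j, u j * g ^ b j := by
    simpa [hax, hby] using hxy
  rw [key a ha, key b hb] at hs
  have hd := digits_unique g k _ _ (bd a) (bd b) hs
  funext j
  have h1 := hdss _ _ (hd (a j) (ha j))
  have h2 : j ∈ univ.filter (fun j' => b j' = a j) := by
    rw [← h1]; simp
  rw [← hax, ← hby, (mem_filter.1 h2).2]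

theorem stmt18 (m : ℕ) (hm : 0 < m) (u : Fin m → ℤ) (hu : ∀ j, 0 < u j)
    (hmono : Monotone u)
    (hdss : ∀ I J : Finset (Fin m), ∑ i ∈ I, u i = ∑ j ∈ J, u j → I = J)
    (k : ℕ) (hk : 0 < k) :
    Mf m u k = k ^ m ∧
    ∀ g : ℤ, (m : ℤ) * u ⟨m - 1, Nat.sub_lt hm Nat.one_pos⟩ < g →
      (fimg m u ((Finset.range k).image fun i : ℕ => g ^ i)).card = k ^ m := by
  have hsum : ∑ j, u j ≤ (m : ℤ) * u ⟨m - 1, Nat.sub_lt hm Nat.one_pos⟩ := by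
    have := sum_le_card_nsmul (univ : Finset (Fin m)) u (u ⟨m - 1, Nat.sub_lt hm Nat.one_pos⟩)
      (fun j _ => hmono (by rw [Fin.le_def]; have := j.2; simp only; omega))
    simpa using this
  have hone : 1 ≤ (m : ℤ) * u ⟨m - 1, Nat.sub_lt hm Nat.one_pos⟩ := by
    have h1 : (0 : ℤ) < m := by exact_mod_cast hm
    exact mul_pos h1 (hu _)
  have H := fun (g : ℤ) (hg : (m : ℤ) * u ⟨m - 1, Nat.sub_lt hm Nat.one_pos⟩ < g) =>
    fimg_pow_card m u hu hdss k g (by linarith) (by linarith)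
  refine ⟨?_, fun g hg => (H g hg).2⟩
  have hg := H _ (lt_add_one _)
  refine IsGreatest.csSup_eq ⟨⟨_, hg.1, hg.2⟩, ?_⟩
  rintro n ⟨A, hA, rfl⟩
  unfold fimg
  refine card_image_le.trans ?_
  rw [Fintype.card_piFinset_const, hA]
end
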